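/- Let Ω be a domain in ℝ^d and B₁ a ball centered on ∂Ω such that ∂Ω ∩ B₁ is C³ smooth. Let x ∈ Ω and R > 0 be such that Ω ∩ B(x,R) is star-shaped with respect to x and B(x,R) ⊂ B₁. Suppose h is continuous on the closure of Ω, harmonic and nonzero in Ω, and h = 0 on ∂Ω ∩ B₁. Then for all 0 < r₁ < r₂ < r₃ < R one has log (H_h(x,r₂)/H_h(x,r₁)) ≤ (log(r₂/r₁)/log(r₃/r₂)) · log (H_h(x,r₃)/H_h(x,r₂)), where H_h(x,r) = ∫_{B(x,r) ∩ Ω} h². -/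

import Mathlib

open Metric MeasureTheory Set
open scoped ENNReal NNReal

noncomputable section

/-- `Euc m` is the Euclidean space `ℝ^(m+1)`. -/
abbrev Euc (m : ℕ) : Type := EuclideanSpace ℝ (Fin (m + 1))

/-- The first `m` coordinates of a point of `ℝ^(m+1)`. -/
def front {m : ℕ} (y : Euc m) : EuclideanSpace ℝ (Fin m) :=
  (WithLp.equiv 2 (∀ _ : Fin m, ℝ)).symm fun i : Fin m => y i.castSucc

/-- The last coordinate of a point of `ℝ^(m+1)`. -/
def lastC {m : ℕ} (y : Euc m) : ℝ := y (Fin.last m)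

/-- The unit vector of `ℝ^(m+1)` in the last coordinate direction. -/
def eLast (m : ℕ) : Euc m := EuclideanSpace.single (Fin.last m) 1

/-- The point `(x', 0) ∈ ℝ^(m+1)` determined by `x' ∈ ℝ^m`. -/
def pad {m : ℕ} (x' : EuclideanSpace ℝ (Fin m)) : Euc m :=
  (WithLp.equiv 2 (∀ _ : Fin (m + 1), ℝ)).symm
    (Fin.snoc (WithLp.equiv 2 (∀ _ : Fin m, ℝ) x') 0)

/-- The Laplacian of `h : ℝ^d → ℝ` at `x`: the sum of the pure second derivatives in the
coordinate directions. -/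
def lap {d : ℕ} (h : EuclideanSpace ℝ (Fin d) → ℝ) (x : EuclideanSpace ℝ (Fin d)) : ℝ :=
  ∑ i : Fin d, iteratedFDeriv ℝ 2 h x ![EuclideanSpace.single i 1, EuclideanSpace.single i 1]

/-- `h` is harmonic on `Ω`: it is twice continuously differentiable there and its
Laplacian vanishes. -/
def IsHarmonicOn {d : ℕ} (h : EuclideanSpace ℝ (Fin d) → ℝ)
    (Ω : Set (EuclideanSpace ℝ (Fin d))) : Prop :=
  ContDiffOn ℝ 2 h Ω ∧ ∀ x ∈ Ω, lap h x = 0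

/-- `H_h(x,r) = ∫_{B(x,r) ∩ Ω} h²`. -/
def Hh {d : ℕ} (Ω : Set (EuclideanSpace ℝ (Fin d))) (h : EuclideanSpace ℝ (Fin d) → ℝ)
    (x : EuclideanSpace ℝ (Fin d)) (r : ℝ) : ℝ :=
  ∫ y in ball x r ∩ Ω, (h y) ^ 2

/-- The doubling index `N_h(x,r) = log (H_h(x,2r) / H_h(x,r))`. -/
def Nh {d : ℕ} (Ω : Set (EuclideanSpace ℝ (Fin d))) (h : EuclideanSpace ℝ (Fin d) → ℝ)
    (x : EuclideanSpace ℝ (Fin d)) (r : ℝ) : ℝ :=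
  Real.log (Hh Ω h x (2 * r) / Hh Ω h x r)

/-- `∂Ω ∩ B(x,r) ∈ Lip(τ)`: in suitable isometric coordinates centered at `x`, `Ω ∩ B(x,r)`
is the region above the graph of a `τ`-Lipschitz function `f` with `f 0 = 0`. -/
def LipGraph {m : ℕ} (Ω : Set (Euc m)) (τ : ℝ≥0) (x : Euc m) (r : ℝ) : Prop :=
  ∃ T : Euc m ≃ᵢ Euc m, ∃ f : EuclideanSpace ℝ (Fin m) → ℝ,
    T 0 = x ∧ LipschitzOnWith τ f (ball 0 r) ∧ f 0 = 0 ∧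
    Ω ∩ ball x r = T '' {y : Euc m | y ∈ ball (0 : Euc m) r ∧ f (front y) < lastC y}

/-- `∂Ω ∩ B(x,r)` is a `C^k`-smooth graph: same as `LipGraph` but with a `C^k` function. -/
def SmoothGraph {m : ℕ} (k : ℕ) (Ω : Set (Euc m)) (x : Euc m) (r : ℝ) : Prop :=
  ∃ T : Euc m ≃ᵢ Euc m, ∃ f : EuclideanSpace ℝ (Fin m) → ℝ,
    T 0 = x ∧ ContDiffOn ℝ k f (ball 0 r) ∧ f 0 = 0 ∧
    Ω ∩ ball x r = T '' {y : Euc m | y ∈ ball (0 : Euc m) r ∧ f (front y) < lastC y}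

/-- The closed axis-parallel cube with center `p` and side length `s`. -/
def cube {d : ℕ} (p : EuclideanSpace ℝ (Fin d)) (s : ℝ) : Set (EuclideanSpace ℝ (Fin d)) :=
  {y | ∀ i, |y i - p i| ≤ s / 2}

/-- The maximal doubling index `N*_h(Q)` of `h` in the cube `Q`. -/
def Nstar {d : ℕ} (Ω : Set (EuclideanSpace ℝ (Fin d))) (h : EuclideanSpace ℝ (Fin d) → ℝ)
    (Q : Set (EuclideanSpace ℝ (Fin d))) : ℝ :=
  sSup {N : ℝ | ∃ x ∈ Q ∩ closure Ω, ∃ r : ℝ,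
    Metric.diam Q / 2 ≤ r ∧ r ≤ Metric.diam Q ∧ N = Nh Ω h x r}

/-- Centers of the boundary cubes `q ∈ B_k(Q)` of the standard construction: `z` lies on
`∂Ω ∩ Q` and its horizontal projection is the center of one of the `2^(k·m)` congruent
subcubes of side `s/2^k` partitioning the projection of `Q`. -/
def bCenters {m : ℕ} (Ω : Set (Euc m)) (xQ : Euc m) (s : ℝ) (k : ℕ) : Set (Euc m) :=
  {z | z ∈ frontier Ω ∩ cube xQ s ∧
    ∃ j : Fin m → Fin (2 ^ k), ∀ i : Fin m,
      front z i = front xQ i - s / 2 + (s / 2 ^ k) * ((j i : ℝ) + 1 / 2)}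

open Filter Topology

/-- The partial derivative of `f` in the `i`-th coordinate direction. -/
def partialD {d : ℕ} (i : Fin d) (f : EuclideanSpace ℝ (Fin d) → ℝ)
    (y : EuclideanSpace ℝ (Fin d)) : ℝ :=
  fderiv ℝ f y (EuclideanSpace.single i 1)

/-- The squared length of the gradient. -/
def gradSq {d : ℕ} (f : EuclideanSpace ℝ (Fin d) → ℝ) (y : EuclideanSpace ℝ (Fin d)) : ℝ :=
  ∑ i, partialD i f y ^ 2

/-- `u` is continuous on the ball of radius `ρ` about the origin, harmonic in the open set `D`
and vanishes in the ball outside `D`. -/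
structure IsZeroExtension {d : ℕ} (D : Set (EuclideanSpace ℝ (Fin d))) (ρ : ℝ)
    (u : EuclideanSpace ℝ (Fin d) → ℝ) : Prop where
  isOpen : IsOpen D
  continuousOn : ContinuousOn u (ball 0 ρ)
  eq_zero : ∀ y ∈ ball (0 : EuclideanSpace ℝ (Fin d)) ρ, y ∉ D → u y = 0
  contDiffOn : ContDiffOn ℝ 2 u D
  laplace : ∀ y ∈ D, ∑ i, partialD i (partialD i u) y = 0

/-- A `C¹` radial weight `ω(|y|²)` supported in the unit ball, its derivative `ω'`, and a
nonnegative primitive `θ` of `-ω` supported in the unit ball. -/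
structure IsRadialWeight (ω ω' θ : ℝ → ℝ) : Prop where
  hasDerivAt : ∀ s, HasDerivAt ω (ω' s) s
  continuous_deriv : Continuous ω'
  hasDerivAt_primitive : ∀ s, HasDerivAt θ (-ω s) s
  nonneg : ∀ s, 0 ≤ ω s
  primitive_nonneg : ∀ s, 0 ≤ θ s
  eq_zero : ∀ s, 1 < s → ω s = 0
  deriv_eq_zero : ∀ s, 1 < s → ω' s = 0
  primitive_eq_zero : ∀ s, 1 < s → θ s = 0

/-- A continuous function with values in `[0, 1]` that vanishes on `[-ε, ε]` and is `1` outside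
`[-2ε, 2ε]`. -/
def truncSlope (ε z : ℝ) : ℝ := min 1 (max 0 (|z| / ε - 1))

/-- A `C¹` approximation of the identity that vanishes on `[-ε, ε]`. -/
def trunc (ε x : ℝ) : ℝ := ∫ t in (0 : ℝ)..x, truncSlope ε t

/-- A `C²` approximation of the square that vanishes on `[-ε, ε]`. -/
def truncSq (ε x : ℝ) : ℝ := ∫ t in (0 : ℝ)..x, 2 * trunc ε t

lemma continuous_truncSlope (ε : ℝ) : Continuous (truncSlope ε) := by
  unfold truncSlope; fun_prop

lemma truncSlope_nonneg (ε z : ℝ) : 0 ≤ truncSlope ε z :=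
  le_min zero_le_one (le_max_left _ _)

lemma truncSlope_le_one (ε z : ℝ) : truncSlope ε z ≤ 1 := min_le_left _ _

lemma truncSlope_eq_zero {ε z : ℝ} (hε : 0 < ε) (hz : |z| ≤ ε) : truncSlope ε z = 0 := by
  have : |z| / ε - 1 ≤ 0 := by
    have := (div_le_one hε).2 hz
    linarith
  simp [truncSlope, max_eq_left this]

lemma hasDerivAt_trunc (ε x : ℝ) : HasDerivAt (trunc ε) (truncSlope ε x) x :=
  intervalIntegral.integral_hasDerivAt_right
    ((continuous_truncSlope ε).intervalIntegrable _ _)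
    ((continuous_truncSlope ε).stronglyMeasurableAtFilter _ _)
    (continuous_truncSlope ε).continuousAt

lemma continuous_trunc (ε : ℝ) : Continuous (trunc ε) :=
  continuous_iff_continuousAt.2 fun x => (hasDerivAt_trunc ε x).continuousAt

lemma hasDerivAt_truncSq (ε x : ℝ) : HasDerivAt (truncSq ε) (2 * trunc ε x) x :=
  intervalIntegral.integral_hasDerivAt_right
    ((continuous_const.mul (continuous_trunc ε)).intervalIntegrable _ _)
    ((continuous_const.mul (continuous_trunc ε)).stronglyMeasurableAtFilter _ _)
    (continuous_const.mul (continuous_trunc ε)).continuousAt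

lemma contDiff_one_of_hasDerivAt {f f' : ℝ → ℝ} (h : ∀ x, HasDerivAt f (f' x) x)
    (hf' : Continuous f') : ContDiff ℝ 1 f := by
  rw [contDiff_one_iff_deriv]
  refine ⟨fun x => (h x).differentiableAt, ?_⟩
  have : deriv f = f' := funext fun x => (h x).deriv
  rwa [this]

lemma contDiff_trunc (ε : ℝ) : ContDiff ℝ 1 (trunc ε) :=
  contDiff_one_of_hasDerivAt (hasDerivAt_trunc ε) (continuous_truncSlope ε)

lemma contDiff_truncSq (ε : ℝ) : ContDiff ℝ 1 (truncSq ε) :=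
  contDiff_one_of_hasDerivAt (hasDerivAt_truncSq ε) (continuous_const.mul (continuous_trunc ε))

lemma abs_le_of_mem_uIoc_zero {x t : ℝ} (ht : t ∈ uIoc 0 x) : |t| ≤ |x| := by
  have h := (mem_uIcc.1 (uIoc_subset_uIcc ht))
  rcases h with h | h
  · rw [abs_of_nonneg h.1, abs_of_nonneg (h.1.trans h.2)]; exact h.2
  · rw [abs_of_nonpos h.2, abs_of_nonpos (h.1.trans h.2)]; linarith

lemma trunc_eq_zero {ε x : ℝ} (hε : 0 < ε) (hx : |x| ≤ ε) : trunc ε x = 0 := by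
  have : ∀ t ∈ uIoc 0 x, ‖truncSlope ε t‖ ≤ 0 := fun t ht => by
    rw [truncSlope_eq_zero hε ((abs_le_of_mem_uIoc_zero ht).trans hx)]; simp
  simpa [trunc] using intervalIntegral.norm_integral_le_of_norm_le_const this

lemma truncSq_eq_zero {ε x : ℝ} (hε : 0 < ε) (hx : |x| ≤ ε) : truncSq ε x = 0 := by
  have : ∀ t ∈ uIoc 0 x, ‖2 * trunc ε t‖ ≤ 0 := fun t ht => by
    rw [trunc_eq_zero hε ((abs_le_of_mem_uIoc_zero ht).trans hx)]; simp
  have := intervalIntegral.norm_integral_le_of_norm_le_const this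
  rw [zero_mul] at this
  exact norm_le_zero_iff.1 this

lemma abs_trunc_le (ε x : ℝ) : |trunc ε x| ≤ |x| := by
  have : ∀ t ∈ uIoc 0 x, ‖truncSlope ε t‖ ≤ 1 := fun t _ => by
    rw [Real.norm_of_nonneg (truncSlope_nonneg _ _)]; exact truncSlope_le_one _ _
  simpa [trunc] using intervalIntegral.norm_integral_le_of_norm_le_const this

lemma abs_truncSq_le (ε x : ℝ) : |truncSq ε x| ≤ 2 * x ^ 2 := by
  have : ∀ t ∈ uIoc 0 x, ‖2 * trunc ε t‖ ≤ 2 * |x| := fun t ht => by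
    rw [norm_mul, Real.norm_ofNat, Real.norm_eq_abs]
    have := (abs_trunc_le ε t).trans (abs_le_of_mem_uIoc_zero ht)
    linarith
  have := intervalIntegral.norm_integral_le_of_norm_le_const this
  rw [sub_zero, mul_assoc, abs_mul_abs_self] at this
  rw [pow_two]
  exact this

lemma tendsto_truncSlope {z : ℝ} (hz : z ≠ 0) :
    Tendsto (fun n : ℕ => truncSlope (1 / ((n : ℝ) + 1)) z) atTop (𝓝 1) := by
  obtain ⟨N, hN⟩ := exists_nat_gt (2 / |z|)
  refine tendsto_const_nhds.congr' ?_
  filter_upwards [eventually_ge_atTop N] with n hn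
  have hz' : 0 < |z| := abs_pos.2 hz
  have hn' : (N : ℝ) ≤ n := by exact_mod_cast hn
  have h2 : 2 ≤ |z| * (n + 1) := by
    rw [div_lt_iff₀ hz'] at hN
    nlinarith
  have : 1 ≤ |z| / (1 / ((n : ℝ) + 1)) - 1 := by
    rw [div_div_eq_mul_div, div_one]; linarith
  rw [truncSlope, max_eq_right (by linarith), min_eq_left this]

lemma tendsto_trunc (x : ℝ) :
    Tendsto (fun n : ℕ => trunc (1 / ((n : ℝ) + 1)) x) atTop (𝓝 x) := by
  have : Tendsto (fun n : ℕ => trunc (1 / ((n : ℝ) + 1)) x) atTop (𝓝 (∫ _ in (0 : ℝ)..x, 1)) := by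
    refine intervalIntegral.tendsto_integral_filter_of_dominated_convergence (fun _ => 1) ?_ ?_
      (by simp) ?_
    · exact Eventually.of_forall fun n => (continuous_truncSlope _).aestronglyMeasurable
    · refine Eventually.of_forall fun n => Eventually.of_forall fun t _ => ?_
      rw [Real.norm_of_nonneg (truncSlope_nonneg _ _)]
      exact truncSlope_le_one _ _
    · filter_upwards [Measure.ae_ne volume (0 : ℝ)] with t ht _
      exact tendsto_truncSlope ht
  simpa using this

lemma tendsto_truncSq (x : ℝ) :
    Tendsto (fun n : ℕ => truncSq (1 / ((n : ℝ) + 1)) x) atTop (𝓝 (x ^ 2)) := by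
  have : Tendsto (fun n : ℕ => truncSq (1 / ((n : ℝ) + 1)) x) atTop
      (𝓝 (∫ t in (0 : ℝ)..x, 2 * t)) := by
    refine intervalIntegral.tendsto_integral_filter_of_dominated_convergence (fun _ => 2 * |x|)
      ?_ ?_ (by simp) ?_
    · exact Eventually.of_forall fun n =>
        (continuous_const.mul (continuous_trunc _)).aestronglyMeasurable
    · refine Eventually.of_forall fun n => Eventually.of_forall fun t ht => ?_
      rw [norm_mul, Real.norm_ofNat, Real.norm_eq_abs]
      have := (abs_trunc_le (1 / ((n : ℝ) + 1)) t).trans (abs_le_of_mem_uIoc_zero ht)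
      linarith
    · exact Eventually.of_forall fun t _ => (tendsto_trunc t).const_mul 2
  have h2 : ∫ t in (0 : ℝ)..x, 2 * t = x ^ 2 := by
    rw [intervalIntegral.integral_const_mul, integral_id]; ring
  rwa [h2] at this

section Fields

variable {d : ℕ} {D D' : Set (EuclideanSpace ℝ (Fin d))} {ρ ε : ℝ}
  {f g u : EuclideanSpace ℝ (Fin d) → ℝ} {ω ω' θ : ℝ → ℝ}

lemma IsZeroExtension.eventually_abs_le (hu : IsZeroExtension D ρ u) (hε : 0 < ε)
    {y : EuclideanSpace ℝ (Fin d)} (hy : y ∈ ball 0 ρ) (hyD : y ∉ D) :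
    ∀ᶠ z in 𝓝 y, z ∈ ball 0 ρ ∧ |u z| ≤ ε := by
  have hc : ContinuousAt u y := hu.continuousOn.continuousAt (isOpen_ball.mem_nhds hy)
  have h0 := hu.eq_zero y hy hyD
  have : ∀ᶠ z in 𝓝 y, |u z| < ε := by
    have h1 : ContinuousAt (fun z => |u z|) y := hc.abs
    exact h1.eventually_lt continuousAt_const (by simpa [h0] using hε)
  filter_upwards [isOpen_ball.mem_nhds hy, this] with z hz hz' using ⟨hz, hz'.le⟩

lemma eventually_one_lt_norm (hρ : 1 < ρ) {y : EuclideanSpace ℝ (Fin d)} (hy : y ∉ ball 0 ρ) :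
    ∀ᶠ z in 𝓝 y, 1 < ‖z‖ := by
  have : 1 < ‖y‖ := by
    rw [mem_ball_zero_iff, not_lt] at hy
    linarith
  exact continuousAt_const.eventually_lt continuous_norm.continuousAt this

/-- A function that vanishes where `|u| ≤ ε` and outside the unit ball vanishes near every point
outside `D`. -/
lemma IsZeroExtension.eventuallyEq_zero (hu : IsZeroExtension D ρ u) (hρ : 1 < ρ) (hε : 0 < ε)
    {G : EuclideanSpace ℝ (Fin d) → ℝ} (h₁ : ∀ y, |u y| ≤ ε → G y = 0)
    (h₂ : ∀ y, 1 < ‖y‖ → G y = 0) {y : EuclideanSpace ℝ (Fin d)} (hy : y ∉ D ∩ ball 0 ρ) :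
    G =ᶠ[𝓝 y] fun _ => 0 := by
  by_cases hyρ : y ∈ ball 0 ρ
  · filter_upwards [hu.eventually_abs_le hε hyρ fun h => hy ⟨h, hyρ⟩] with z hz using h₁ z hz.2
  · filter_upwards [eventually_one_lt_norm hρ hyρ] with z hz using h₂ z hz

lemma IsZeroExtension.contDiff_of_vanishing (hu : IsZeroExtension D ρ u) (hρ : 1 < ρ)
    (hε : 0 < ε) {n : WithTop ℕ∞} {G : EuclideanSpace ℝ (Fin d) → ℝ}
    (h₀ : ∀ y ∈ D, y ∈ ball 0 ρ → ContDiffAt ℝ n G y) (h₁ : ∀ y, |u y| ≤ ε → G y = 0)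
    (h₂ : ∀ y, 1 < ‖y‖ → G y = 0) : ContDiff ℝ n G := by
  rw [contDiff_iff_contDiffAt]
  intro y
  by_cases hy : y ∈ D ∩ ball 0 ρ
  · exact h₀ y hy.1 hy.2
  · exact contDiffAt_const.congr_of_eventuallyEq (hu.eventuallyEq_zero hρ hε h₁ h₂ hy)

lemma hasCompactSupport_of_vanishing {G : EuclideanSpace ℝ (Fin d) → ℝ}
    (h₂ : ∀ y, 1 < ‖y‖ → G y = 0) : HasCompactSupport G := by
  refine HasCompactSupport.intro (isCompact_closedBall 0 1) fun y hy => h₂ y ?_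
  simpa using hy

/-- The integral of a derivative of a compactly supported `C¹` function vanishes. -/
lemma integral_partialD_eq_zero {G : EuclideanSpace ℝ (Fin d) → ℝ} (hG : ContDiff ℝ 1 G)
    (hc : HasCompactSupport G) (i : Fin d) :
    Integrable (partialD i G) ∧ ∫ y, partialD i G y = 0 := by
  have h1 : Integrable (partialD i G) := by
    refine Continuous.integrable_of_hasCompactSupport ?_ ?_
    · exact (hG.continuous_fderiv one_ne_zero).clm_apply continuous_const
    · exact hc.fderiv_apply ℝ _
  refine ⟨h1, ?_⟩
  have := integral_mul_fderiv_eq_neg_fderiv_mul_of_integrable (𝕜 := ℝ) (μ := volume)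
    (f := fun _ : EuclideanSpace ℝ (Fin d) => (1 : ℝ)) (g := G)
    (v := EuclideanSpace.single i 1) (by simp) (by simp only [one_mul]; exact h1)
    (by simpa using hG.continuous.integrable_of_hasCompactSupport hc)
    (by simp) (fun x _ => hG.differentiable one_ne_zero x)
  simpa [partialD] using this

lemma IsZeroExtension.contDiffAt (hu : IsZeroExtension D ρ u) {y : EuclideanSpace ℝ (Fin d)}
    (hy : y ∈ D) : ContDiffAt ℝ 2 u y :=
  hu.contDiffOn.contDiffAt (hu.isOpen.mem_nhds hy)

lemma IsZeroExtension.contDiffAt_partialD (hu : IsZeroExtension D ρ u)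
    {y : EuclideanSpace ℝ (Fin d)} (hy : y ∈ D) (i : Fin d) : ContDiffAt ℝ 1 (partialD i u) y := by
  have : ContDiffAt ℝ 1 (fderiv ℝ u) y := (hu.contDiffAt hy).fderiv_right (by norm_num)
  exact this.clm_apply contDiffAt_const

lemma IsRadialWeight.contDiff (hω : IsRadialWeight ω ω' θ) : ContDiff ℝ 1 ω :=
  contDiff_one_of_hasDerivAt hω.hasDerivAt hω.continuous_deriv

lemma IsRadialWeight.contDiff_primitive (hω : IsRadialWeight ω ω' θ) : ContDiff ℝ 1 θ :=
  contDiff_one_of_hasDerivAt hω.hasDerivAt_primitive hω.contDiff.continuous.neg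

lemma one_lt_sq_norm {y : EuclideanSpace ℝ (Fin d)} (hy : 1 < ‖y‖) : 1 < ‖y‖ ^ 2 := by
  nlinarith

lemma fderiv_apply_self_eq_sum (f : EuclideanSpace ℝ (Fin d) → ℝ)
    (y : EuclideanSpace ℝ (Fin d)) : fderiv ℝ f y y = ∑ i, y i * partialD i f y := by
  have h : y = ∑ i, y i • EuclideanSpace.single i (1 : ℝ) := by
    ext j
    simp [Pi.single_apply]
  have h2 : fderiv ℝ f y y = fderiv ℝ f y (∑ i, y i • EuclideanSpace.single i (1 : ℝ)) :=
    congrArg _ h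
  rw [h2, map_sum]
  simp [partialD]

lemma hasFDerivAt_comp_sq_norm {p : ℝ → ℝ} {p' : ℝ} {y : EuclideanSpace ℝ (Fin d)}
    (hp : HasDerivAt p p' (‖y‖ ^ 2)) :
    HasFDerivAt (fun z : EuclideanSpace ℝ (Fin d) => p (‖z‖ ^ 2)) (p' • (2 • innerSL ℝ y)) y :=
  hp.comp_hasFDerivAt y (hasStrictFDerivAt_norm_sq y).hasFDerivAt

lemma innerSL_single (y : EuclideanSpace ℝ (Fin d)) (i : Fin d) :
    innerSL ℝ y (EuclideanSpace.single i 1) = y i := by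
  simp [EuclideanSpace.inner_single_right]

end Fields

section Energy

variable {d : ℕ} {D D' : Set (EuclideanSpace ℝ (Fin d))} {ρ ε : ℝ}
  {f g u : EuclideanSpace ℝ (Fin d) → ℝ} {ω ω' θ : ℝ → ℝ}

/-- The vector field `θ(|y|²) φ_ε(g) ∇f`. -/
def gradField (θ : ℝ → ℝ) (ε : ℝ) (g f : EuclideanSpace ℝ (Fin d) → ℝ) (i : Fin d)
    (y : EuclideanSpace ℝ (Fin d)) : ℝ :=
  θ (‖y‖ ^ 2) * trunc ε (g y) * partialD i f y

/-- The vector field `ω(|y|²) Φ_ε(u) y`. -/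
def radialField (ω : ℝ → ℝ) (ε : ℝ) (u : EuclideanSpace ℝ (Fin d) → ℝ) (i : Fin d)
    (y : EuclideanSpace ℝ (Fin d)) : ℝ :=
  ω (‖y‖ ^ 2) * truncSq ε (u y) * y i

lemma IsZeroExtension.gradField_regular (hω : IsRadialWeight ω ω' θ)
    (hf : IsZeroExtension D ρ f) (hg : IsZeroExtension D' ρ g) (hD : D' ⊆ D) (hρ : 1 < ρ)
    (hε : 0 < ε) (i : Fin d) :
    ContDiff ℝ 1 (gradField θ ε g f i) ∧ HasCompactSupport (gradField θ ε g f i) := by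
  have h₂ : ∀ y, 1 < ‖y‖ → gradField θ ε g f i y = 0 := fun y hy => by
    simp [gradField, hω.primitive_eq_zero _ (one_lt_sq_norm hy)]
  refine ⟨hg.contDiff_of_vanishing hρ hε (fun y hy _ => ?_) (fun y hy => ?_) h₂,
    hasCompactSupport_of_vanishing h₂⟩
  · refine ContDiffAt.mul (ContDiffAt.mul ?_ ?_) (hf.contDiffAt_partialD (hD hy) i)
    · exact (hω.contDiff_primitive.comp (contDiff_norm_sq ℝ)).contDiffAt
    · exact (contDiff_trunc ε).contDiffAt.comp y ((hg.contDiffAt hy).of_le (by norm_num))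
  · simp [gradField, trunc_eq_zero hε hy]

lemma IsZeroExtension.radialField_regular (hω : IsRadialWeight ω ω' θ)
    (hu : IsZeroExtension D ρ u) (hρ : 1 < ρ) (hε : 0 < ε) (i : Fin d) :
    ContDiff ℝ 1 (radialField ω ε u i) ∧ HasCompactSupport (radialField ω ε u i) := by
  have h₂ : ∀ y, 1 < ‖y‖ → radialField ω ε u i y = 0 := fun y hy => by
    simp [radialField, hω.eq_zero _ (one_lt_sq_norm hy)]
  refine ⟨hu.contDiff_of_vanishing hρ hε (fun y hy _ => ?_) (fun y hy => ?_) h₂,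
    hasCompactSupport_of_vanishing h₂⟩
  · refine ContDiffAt.mul (ContDiffAt.mul ?_ ?_) (by fun_prop)
    · exact (hω.contDiff.comp (contDiff_norm_sq ℝ)).contDiffAt
    · exact (contDiff_truncSq ε).contDiffAt.comp y ((hu.contDiffAt hy).of_le (by norm_num))
  · simp [radialField, truncSq_eq_zero hε hy]

lemma IsZeroExtension.sum_partialD_gradField (hω : IsRadialWeight ω ω' θ)
    (hf : IsZeroExtension D ρ f) (hg : IsZeroExtension D' ρ g) (hD : D' ⊆ D) (hρ : 1 < ρ)
    (hε : 0 < ε) (y : EuclideanSpace ℝ (Fin d)) :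
    ∑ i, partialD i (gradField θ ε g f i) y =
      θ (‖y‖ ^ 2) * truncSlope ε (g y) * ∑ i, partialD i g y * partialD i f y
        - 2 * (ω (‖y‖ ^ 2) * trunc ε (g y) * fderiv ℝ f y y) := by
  by_cases hy : y ∈ D' ∩ ball 0 ρ
  · have key : ∀ i, partialD i (gradField θ ε g f i) y =
        θ (‖y‖ ^ 2) * truncSlope ε (g y) * (partialD i g y * partialD i f y)
        - 2 * (ω (‖y‖ ^ 2) * trunc ε (g y)) * (y i * partialD i f y)
        + θ (‖y‖ ^ 2) * trunc ε (g y) * partialD i (partialD i f) y := by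
      intro i
      have h1 := hasFDerivAt_comp_sq_norm (hω.hasDerivAt_primitive (‖y‖ ^ 2))
      have h2 := (hasDerivAt_trunc ε (g y)).comp_hasFDerivAt y
        ((hg.contDiffAt hy.1).differentiableAt (by norm_num)).hasFDerivAt
      have h3 := ((hf.contDiffAt_partialD (hD hy.1) i).differentiableAt
        (by norm_num)).hasFDerivAt
      have h4 := ((h1.mul h2).mul h3).fderiv
      have h5 : gradField θ ε g f i = (fun z => θ (‖z‖ ^ 2)) * (trunc ε ∘ g) * partialD i f := rfl
      rw [partialD, h5, h4]
      simp only [add_apply, smul_apply, smul_eq_mul,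
        innerSL_single, nsmul_eq_mul, Pi.mul_apply, Function.comp_apply]
      simp only [partialD]
      push_cast
      ring
    rw [Finset.sum_congr rfl fun i _ => key i, Finset.sum_add_distrib, Finset.sum_sub_distrib,
      ← Finset.mul_sum, ← Finset.mul_sum, ← Finset.mul_sum, hf.laplace y (hD hy.1),
      fderiv_apply_self_eq_sum]
    ring
  · have h0 : ∀ i, partialD i (gradField θ ε g f i) y = 0 := fun i => by
      have : gradField θ ε g f i =ᶠ[𝓝 y] fun _ => 0 :=
        hg.eventuallyEq_zero hρ hε (fun z hz => by simp [gradField, trunc_eq_zero hε hz])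
          (fun z hz => by simp [gradField, hω.primitive_eq_zero _ (one_lt_sq_norm hz)]) hy
      rw [partialD, this.fderiv_eq]
      simp
    rw [Finset.sum_eq_zero fun i _ => h0 i]
    by_cases hyρ : y ∈ ball 0 ρ
    · have hg0 : g y = 0 := hg.eq_zero y hyρ fun h => hy ⟨h, hyρ⟩
      rw [hg0, trunc_eq_zero hε (by simpa using hε.le),
        truncSlope_eq_zero hε (by simpa using hε.le)]
      simp
    · have hy1 := one_lt_sq_norm (eventually_one_lt_norm hρ hyρ).self_of_nhds
      simp [hω.eq_zero _ hy1, hω.primitive_eq_zero _ hy1]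

lemma IsZeroExtension.sum_partialD_radialField (hω : IsRadialWeight ω ω' θ)
    (hu : IsZeroExtension D ρ u) (hρ : 1 < ρ) (hε : 0 < ε) (y : EuclideanSpace ℝ (Fin d)) :
    ∑ i, partialD i (radialField ω ε u i) y =
      (d * ω (‖y‖ ^ 2) + 2 * ‖y‖ ^ 2 * ω' (‖y‖ ^ 2)) * truncSq ε (u y)
        + 2 * (ω (‖y‖ ^ 2) * trunc ε (u y) * fderiv ℝ u y y) := by
  by_cases hy : y ∈ D ∩ ball 0 ρ
  · have key : ∀ i, partialD i (radialField ω ε u i) y =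
        2 * ω' (‖y‖ ^ 2) * truncSq ε (u y) * (y i * y i)
        + 2 * (ω (‖y‖ ^ 2) * trunc ε (u y)) * (y i * partialD i u y)
        + ω (‖y‖ ^ 2) * truncSq ε (u y) := by
      intro i
      have h1 := hasFDerivAt_comp_sq_norm (hω.hasDerivAt (‖y‖ ^ 2))
      have h2 := (hasDerivAt_truncSq ε (u y)).comp_hasFDerivAt y
        ((hu.contDiffAt hy.1).differentiableAt (by norm_num)).hasFDerivAt
      have h3 := (EuclideanSpace.proj (𝕜 := ℝ) i :
        EuclideanSpace ℝ (Fin d) →L[ℝ] ℝ).hasFDerivAt (x := y)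
      have h4 := ((h1.mul h2).mul h3).fderiv
      have h5 : radialField ω ε u i =
        (fun z => ω (‖z‖ ^ 2)) * (truncSq ε ∘ u) *
          ⇑(EuclideanSpace.proj (𝕜 := ℝ) i : EuclideanSpace ℝ (Fin d) →L[ℝ] ℝ) := rfl
      rw [partialD, h5, h4]
      simp only [add_apply, smul_apply, smul_eq_mul,
        innerSL_single, nsmul_eq_mul, Pi.mul_apply, Function.comp_apply]
      simp only [partialD]
      simp
      ring
    rw [Finset.sum_congr rfl fun i _ => key i, Finset.sum_add_distrib, Finset.sum_add_distrib,
      ← Finset.mul_sum, ← Finset.mul_sum, fderiv_apply_self_eq_sum, EuclideanSpace.real_norm_sq_eq]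
    simp only [Finset.sum_const, Finset.card_univ, Fintype.card_fin, nsmul_eq_mul, pow_two]
    ring
  · have h0 : ∀ i, partialD i (radialField ω ε u i) y = 0 := fun i => by
      have : radialField ω ε u i =ᶠ[𝓝 y] fun _ => 0 :=
        hu.eventuallyEq_zero hρ hε (fun z hz => by simp [radialField, truncSq_eq_zero hε hz])
          (fun z hz => by simp [radialField, hω.eq_zero _ (one_lt_sq_norm hz)]) hy
      rw [partialD, this.fderiv_eq]
      simp
    rw [Finset.sum_eq_zero fun i _ => h0 i]
    by_cases hyρ : y ∈ ball 0 ρ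
    · have hg0 : u y = 0 := hu.eq_zero y hyρ fun h => hy ⟨h, hyρ⟩
      rw [hg0, trunc_eq_zero hε (by simpa using hε.le), truncSq_eq_zero hε (by simpa using hε.le)]
      simp
    · have hy1 := one_lt_sq_norm (eventually_one_lt_norm hρ hyρ).self_of_nhds
      simp [hω.eq_zero _ hy1, hω.deriv_eq_zero _ hy1]

/-- The quadratic form `-∫ div(ω(|y|²) y) u²`. -/
def radialForm (ω ω' : ℝ → ℝ) (u : EuclideanSpace ℝ (Fin d) → ℝ) : ℝ :=
  -∫ y, (d * ω (‖y‖ ^ 2) + 2 * ‖y‖ ^ 2 * ω' (‖y‖ ^ 2)) * u y ^ 2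

lemma continuous_mul_of_vanishing {w v : EuclideanSpace ℝ (Fin d) → ℝ} (hρ : 1 < ρ)
    (hw : Continuous w) (hw0 : ∀ y, 1 < ‖y‖ → w y = 0) (hv : ContinuousOn v (ball 0 ρ)) :
    Continuous fun y => w y * v y := by
  rw [continuous_iff_continuousAt]
  intro y
  by_cases hy : y ∈ ball 0 ρ
  · exact hw.continuousAt.mul (hv.continuousAt (isOpen_ball.mem_nhds hy))
  · refine continuousAt_const.congr (f := fun _ => (0 : ℝ)) ?_
    filter_upwards [eventually_one_lt_norm hρ hy] with z hz
    simp [hw0 z hz]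

lemma integrable_mul_of_vanishing {w v : EuclideanSpace ℝ (Fin d) → ℝ} (hρ : 1 < ρ)
    (hw : Continuous w) (hw0 : ∀ y, 1 < ‖y‖ → w y = 0) (hv : ContinuousOn v (ball 0 ρ)) :
    Integrable fun y => w y * v y :=
  (continuous_mul_of_vanishing hρ hw hw0 hv).integrable_of_hasCompactSupport
    (hasCompactSupport_of_vanishing fun y hy => by simp [hw0 y hy])

lemma IsRadialWeight.divergence_regular (hω : IsRadialWeight ω ω' θ) :
    Continuous (fun y : EuclideanSpace ℝ (Fin d) =>
      d * ω (‖y‖ ^ 2) + 2 * ‖y‖ ^ 2 * ω' (‖y‖ ^ 2)) ∧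
    ∀ y : EuclideanSpace ℝ (Fin d), 1 < ‖y‖ →
      d * ω (‖y‖ ^ 2) + 2 * ‖y‖ ^ 2 * ω' (‖y‖ ^ 2) = 0 := by
  refine ⟨?_, fun y hy => ?_⟩
  · have := hω.contDiff.continuous
    have := hω.continuous_deriv
    fun_prop
  · simp [hω.eq_zero _ (one_lt_sq_norm hy), hω.deriv_eq_zero _ (one_lt_sq_norm hy)]

lemma gradSq_nonneg (f : EuclideanSpace ℝ (Fin d) → ℝ) (y : EuclideanSpace ℝ (Fin d)) :
    0 ≤ gradSq f y := Finset.sum_nonneg fun _ _ => sq_nonneg _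

/-- The gradient vanishes almost everywhere on the zero set. -/
lemma IsZeroExtension.ae_gradSq_eq_zero (hu : IsZeroExtension D ρ u) :
    ∀ᵐ y, y ∈ D → u y = 0 → gradSq u y = 0 := by
  have hs : MeasurableSet (D ∩ u ⁻¹' {0}) := by
    have h1 : IsOpen (D ∩ u ⁻¹' {0}ᶜ) :=
      hu.contDiffOn.continuousOn.isOpen_inter_preimage hu.isOpen isOpen_compl_singleton
    have h2 : D ∩ u ⁻¹' {0} = D \ (D ∩ u ⁻¹' {0}ᶜ) := by ext; simp
    rw [h2]
    exact hu.isOpen.measurableSet.diff h1.measurableSet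
  have hpart : ∀ i : Fin d, ∀ᵐ y, y ∈ D → u y = 0 → partialD i u y = 0 := by
    intro i
    have happ : ApproximatesLinearOn (fun y => u y • EuclideanSpace.single i (1 : ℝ))
        (0 : EuclideanSpace ℝ (Fin d) →L[ℝ] EuclideanSpace ℝ (Fin d)) (D ∩ u ⁻¹' {0}) 0 := by
      intro a ha b hb
      have ha' : u a = 0 := ha.2
      have hb' : u b = 0 := hb.2
      simp [ha', hb']
    have := happ.norm_fderiv_sub_le volume hs
      (fun y => (fderiv ℝ u y).smulRight (EuclideanSpace.single i (1 : ℝ))) fun y hy =>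
        (((hu.contDiffAt hy.1).differentiableAt (by norm_num)).hasFDerivAt.smul_const
          _).hasFDerivWithinAt
    rw [ae_restrict_iff' hs] at this
    filter_upwards [this] with y hy hyD hy0
    have h3 : fderiv ℝ u y = 0 := by simpa using hy ⟨hyD, hy0⟩
    simp [partialD, h3]
  filter_upwards [ae_all_iff.2 hpart] with y hy hyD hy0
  simp [gradSq, fun i => hy i hyD hy0]

lemma IsZeroExtension.integral_truncated_energy (hω : IsRadialWeight ω ω' θ)
    (hu : IsZeroExtension D ρ u) (hρ : 1 < ρ) (hε : 0 < ε) :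
    Integrable (fun y => θ (‖y‖ ^ 2) * truncSlope ε (u y) * gradSq u y) ∧
    ∫ y, θ (‖y‖ ^ 2) * truncSlope ε (u y) * gradSq u y =
      -∫ y, (d * ω (‖y‖ ^ 2) + 2 * ‖y‖ ^ 2 * ω' (‖y‖ ^ 2)) * truncSq ε (u y) := by
  have hY i := integral_partialD_eq_zero (hu.gradField_regular hω hu subset_rfl hρ hε i).1
    (hu.gradField_regular hω hu subset_rfl hρ hε i).2 i
  have hW i := integral_partialD_eq_zero (hu.radialField_regular hω hρ hε i).1
    (hu.radialField_regular hω hρ hε i).2 i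
  have hB : Integrable fun y : EuclideanSpace ℝ (Fin d) =>
      (d * ω (‖y‖ ^ 2) + 2 * ‖y‖ ^ 2 * ω' (‖y‖ ^ 2)) * truncSq ε (u y) :=
    integrable_mul_of_vanishing hρ hω.divergence_regular.1 hω.divergence_regular.2
      ((contDiff_truncSq ε).continuous.comp_continuousOn hu.continuousOn)
  have hY' := integrable_finsetSum Finset.univ fun i _ => (hY i).1
  have hW' := integrable_finsetSum Finset.univ fun i _ => (hW i).1
  have heq : (fun y => θ (‖y‖ ^ 2) * truncSlope ε (u y) * gradSq u y) = fun y =>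
      ((∑ i, partialD i (gradField θ ε u u i) y) + ∑ i, partialD i (radialField ω ε u i) y)
        - (d * ω (‖y‖ ^ 2) + 2 * ‖y‖ ^ 2 * ω' (‖y‖ ^ 2)) * truncSq ε (u y) := by
    funext y
    rw [hu.sum_partialD_gradField hω hu subset_rfl hρ hε, hu.sum_partialD_radialField hω hρ hε]
    simp only [gradSq, pow_two]
    ring
  rw [heq]
  refine ⟨(hY'.add hW').sub hB, ?_⟩
  have h3 := integral_sub (hY'.add hW') hB
  simp only [Pi.add_apply] at h3
  rw [h3, integral_add hY' hW',
    integral_finsetSum _ fun i _ => (hY i).1, integral_finsetSum _ fun i _ => (hW i).1,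
    Finset.sum_eq_zero fun i _ => (hY i).2, Finset.sum_eq_zero fun i _ => (hW i).2]
  ring

/-- The weighted Dirichlet energy is finite and bounded by the radial form. -/
lemma IsZeroExtension.energy_le (hω : IsRadialWeight ω ω' θ) (hu : IsZeroExtension D ρ u)
    (hρ : 1 < ρ) :
    Integrable (D.indicator fun y => θ (‖y‖ ^ 2) * gradSq u y) ∧
    ∫ y, D.indicator (fun y => θ (‖y‖ ^ 2) * gradSq u y) y ≤ radialForm ω ω' u := by
  set A : EuclideanSpace ℝ (Fin d) → ℝ := D.indicator fun y => θ (‖y‖ ^ 2) * gradSq u y with hA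
  set An : ℕ → EuclideanSpace ℝ (Fin d) → ℝ := fun n y =>
    θ (‖y‖ ^ 2) * truncSlope (1 / ((n : ℝ) + 1)) (u y) * gradSq u y with hAn
  have hpos : ∀ n : ℕ, 0 < 1 / ((n : ℝ) + 1) := fun n => Nat.one_div_pos_of_nat
  have hint n := hu.integral_truncated_energy hω hρ (hpos n)
  have hA0 : ∀ y, 0 ≤ A y := fun y => indicator_nonneg
    (fun z _ => mul_nonneg (hω.primitive_nonneg _) (gradSq_nonneg _ _)) y
  have hAn0 : ∀ n y, 0 ≤ An n y := fun n y => mul_nonneg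
    (mul_nonneg (hω.primitive_nonneg _) (truncSlope_nonneg _ _)) (gradSq_nonneg _ _)
  have hlim : ∀ᵐ y, Tendsto (fun n => An n y) atTop (𝓝 (A y)) := by
    filter_upwards [hu.ae_gradSq_eq_zero] with y hy
    by_cases hyD : y ∈ D
    · simp only [hA, hAn, indicator_of_mem hyD]
      by_cases hu0 : u y = 0
      · simp [hy hyD hu0]
      · simpa using ((tendsto_truncSlope hu0).const_mul (θ (‖y‖ ^ 2))).mul_const (gradSq u y)
    · simp only [hA, hAn, indicator_of_notMem hyD]
      by_cases hyρ : y ∈ ball 0 ρ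
      · refine tendsto_const_nhds.congr fun n => ?_
        rw [hu.eq_zero y hyρ hyD, truncSlope_eq_zero (hpos n) (by simpa using (hpos n).le)]
        simp
      · have hy1 := one_lt_sq_norm (eventually_one_lt_norm hρ hyρ).self_of_nhds
        simp [hω.primitive_eq_zero _ hy1]
  have hmeas : AEMeasurable A := aemeasurable_of_tendsto_metrizable_ae'
    (fun n => (hint n).1.aemeasurable) hlim
  have hconv : Tendsto (fun n => ∫ y, An n y) atTop (𝓝 (radialForm ω ω' u)) := by
    simp only [hAn, (hint _).2]
    refine Tendsto.neg ?_
    refine tendsto_integral_of_dominated_convergence (fun y =>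
      |d * ω (‖y‖ ^ 2) + 2 * ‖y‖ ^ 2 * ω' (‖y‖ ^ 2)| * (2 * u y ^ 2)) (fun n => ?_) ?_
      (fun n => Eventually.of_forall fun y => ?_) (Eventually.of_forall fun y => ?_)
    · exact (integrable_mul_of_vanishing hρ hω.divergence_regular.1 hω.divergence_regular.2
        ((contDiff_truncSq _).continuous.comp_continuousOn hu.continuousOn)).aestronglyMeasurable
    · refine integrable_mul_of_vanishing hρ hω.divergence_regular.1.abs (fun y hy => ?_)
        (continuousOn_const.mul (hu.continuousOn.pow 2))
      rw [hω.divergence_regular.2 y hy, abs_zero]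
    · rw [norm_mul, Real.norm_eq_abs, Real.norm_eq_abs]
      exact mul_le_mul_of_nonneg_left (abs_truncSq_le _ _) (abs_nonneg _)
    · exact (tendsto_truncSq _).const_mul _
  have hlint : ∫⁻ y, ENNReal.ofReal (A y) ≤ ENNReal.ofReal (radialForm ω ω' u) := by
    calc ∫⁻ y, ENNReal.ofReal (A y)
        = ∫⁻ y, liminf (fun n => ENNReal.ofReal (An n y)) atTop := by
          refine lintegral_congr_ae ?_
          filter_upwards [hlim] with y hy
          exact ((ENNReal.tendsto_ofReal hy).liminf_eq).symm
      _ ≤ liminf (fun n => ∫⁻ y, ENNReal.ofReal (An n y)) atTop :=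
          lintegral_liminf_le' fun n => (hint n).1.aemeasurable.ennreal_ofReal
      _ = ENNReal.ofReal (radialForm ω ω' u) := by
          have : ∀ n, ∫⁻ y, ENNReal.ofReal (An n y) = ENNReal.ofReal (∫ y, An n y) := fun n =>
            (ofReal_integral_eq_lintegral_ofReal (hint n).1
              (Eventually.of_forall (hAn0 n))).symm
          simp only [this]
          exact (ENNReal.tendsto_ofReal hconv).liminf_eq
  have hform : 0 ≤ radialForm ω ω' u :=
    ge_of_tendsto' hconv fun n => integral_nonneg (hAn0 n)
  refine ⟨⟨hmeas.aestronglyMeasurable, ?_⟩, ?_⟩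
  · rw [hasFiniteIntegral_iff_ofReal (Eventually.of_forall hA0)]
    exact hlint.trans_lt ENNReal.ofReal_lt_top
  · rw [integral_eq_lintegral_of_nonneg_ae (Eventually.of_forall hA0)
      hmeas.aestronglyMeasurable]
    exact ENNReal.toReal_le_of_le_ofReal hform hlint

lemma IsZeroExtension.radialForm_nonneg (hω : IsRadialWeight ω ω' θ)
    (hu : IsZeroExtension D ρ u) (hρ : 1 < ρ) : 0 ≤ radialForm ω ω' u :=
  (integral_nonneg fun y => indicator_nonneg
    (fun _ _ => mul_nonneg (hω.primitive_nonneg _) (gradSq_nonneg _ _)) y).trans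
    (hu.energy_le hω hρ).2

lemma IsZeroExtension.integrable_flux (hω : IsRadialWeight ω ω' θ)
    (hf : IsZeroExtension D ρ f) (hg : IsZeroExtension D' ρ g) (hD : D' ⊆ D) (hρ : 1 < ρ)
    (hε : 0 < ε) : Integrable fun y => ω (‖y‖ ^ 2) * trunc ε (g y) * fderiv ℝ f y y := by
  have h₂ : ∀ y, 1 < ‖y‖ → ω (‖y‖ ^ 2) * trunc ε (g y) * fderiv ℝ f y y = 0 := fun y hy => by
    simp [hω.eq_zero _ (one_lt_sq_norm hy)]
  refine Continuous.integrable_of_hasCompactSupport ?_ (hasCompactSupport_of_vanishing h₂)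
  rw [← contDiff_zero (𝕜 := ℝ)]
  refine hg.contDiff_of_vanishing hρ hε (fun y hy _ => ?_) (fun y hy => ?_) h₂
  · refine ContDiffAt.mul (ContDiffAt.mul ?_ ?_) ?_
    · exact ((hω.contDiff.comp (contDiff_norm_sq ℝ)).of_le (by simp)).contDiffAt
    · exact ((contDiff_trunc ε).of_le (by simp)).contDiffAt.comp y
        ((hg.contDiffAt hy).of_le (by simp))
    · have : ContDiffAt ℝ 0 (fderiv ℝ f) y :=
        (hf.contDiffAt (hD hy)).fderiv_right (by norm_num)
      exact this.clm_apply contDiffAt_id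
  · simp [trunc_eq_zero hε hy]

/-- Testing the equation of `f` with a truncation of a function `g` supported in a smaller set. -/
lemma IsZeroExtension.four_mul_integral_le (hω : IsRadialWeight ω ω' θ)
    (hf : IsZeroExtension D ρ f) (hg : IsZeroExtension D' ρ g) (hD : D' ⊆ D) (hρ : 1 < ρ)
    (hε : 0 < ε) :
    4 * ∫ y, ω (‖y‖ ^ 2) * trunc ε (g y) * fderiv ℝ f y y ≤
      radialForm ω ω' f + radialForm ω ω' g := by
  have hY i := integral_partialD_eq_zero (hf.gradField_regular hω hg hD hρ hε i).1
    (hf.gradField_regular hω hg hD hρ hε i).2 i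
  have hY' := integrable_finsetSum Finset.univ fun i _ => (hY i).1
  have hEf := hf.energy_le hω hρ
  have hEg := hg.energy_le hω hρ
  have hL := hf.integrable_flux hω hg hD hρ hε
  have hpt : ∀ y, 4 * (ω (‖y‖ ^ 2) * trunc ε (g y) * fderiv ℝ f y y) ≤
      D.indicator (fun y => θ (‖y‖ ^ 2) * gradSq f y) y
      + D'.indicator (fun y => θ (‖y‖ ^ 2) * gradSq g y) y
      - 2 * ∑ i, partialD i (gradField θ ε g f i) y := by
    intro y
    rw [hf.sum_partialD_gradField hω hg hD hρ hε]
    suffices h : 2 * (θ (‖y‖ ^ 2) * truncSlope ε (g y) * ∑ i, partialD i g y * partialD i f y) ≤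
        D.indicator (fun y => θ (‖y‖ ^ 2) * gradSq f y) y
        + D'.indicator (fun y => θ (‖y‖ ^ 2) * gradSq g y) y by linarith
    by_cases hy : y ∈ D'
    · rw [indicator_of_mem hy, indicator_of_mem (hD hy), ← mul_add]
      have h1 : 2 * (truncSlope ε (g y) * ∑ i, partialD i g y * partialD i f y) ≤
          gradSq f y + gradSq g y := by
        rw [gradSq, gradSq, ← Finset.sum_add_distrib, Finset.mul_sum, Finset.mul_sum]
        refine Finset.sum_le_sum fun i _ => ?_
        have h0 := truncSlope_nonneg ε (g y)
        have h1 := truncSlope_le_one ε (g y)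
        nlinarith [mul_nonneg h0 (sq_nonneg (partialD i g y - partialD i f y)),
          mul_nonneg (sub_nonneg.2 h1) (add_nonneg (sq_nonneg (partialD i g y))
            (sq_nonneg (partialD i f y)))]
      have := mul_le_mul_of_nonneg_left h1 (hω.primitive_nonneg (‖y‖ ^ 2))
      linarith
    · rw [indicator_of_notMem hy, add_zero]
      have h0 : θ (‖y‖ ^ 2) * truncSlope ε (g y) = 0 := by
        by_cases hyρ : y ∈ ball 0 ρ
        · rw [hg.eq_zero y hyρ hy, truncSlope_eq_zero hε (by simpa using hε.le), mul_zero]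
        · rw [hω.primitive_eq_zero _
            (one_lt_sq_norm (eventually_one_lt_norm hρ hyρ).self_of_nhds), zero_mul]
      rw [h0, zero_mul, mul_zero]
      exact indicator_nonneg
        (fun z _ => mul_nonneg (hω.primitive_nonneg _) (gradSq_nonneg _ _)) y
  have := integral_mono (hL.const_mul 4) ((hEf.1.add hEg.1).sub (hY'.const_mul 2)) hpt
  rw [integral_const_mul] at this
  refine this.trans ?_
  have h3 := integral_sub (hEf.1.add hEg.1) (hY'.const_mul 2)
  have h4 := integral_add hEf.1 hEg.1
  simp only [Pi.add_apply, Pi.sub_apply] at h3 h4 ⊢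
  rw [h3, h4, integral_const_mul, integral_finsetSum _ fun i _ => (hY i).1,
    Finset.sum_eq_zero fun i _ => (hY i).2]
  linarith [hEf.2, hEg.2]

end Energy

section Dilation

variable {d : ℕ} {D : Set (EuclideanSpace ℝ (Fin d))} {ρ ε : ℝ}
  {u : EuclideanSpace ℝ (Fin d) → ℝ} {ω ω' θ : ℝ → ℝ}

/-- The dilated function `y ↦ u (exp s • y)`. -/
def dilate (u : EuclideanSpace ℝ (Fin d) → ℝ) (s : ℝ) (y : EuclideanSpace ℝ (Fin d)) : ℝ :=
  u (Real.exp s • y)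

/-- The weighted square mean of the dilations of `u`. -/
def weightedMean (ω : ℝ → ℝ) (u : EuclideanSpace ℝ (Fin d) → ℝ) (s : ℝ) : ℝ :=
  ∫ y, ω (‖y‖ ^ 2) * dilate u s y ^ 2

lemma partialD_comp_smul (c : ℝ) (f : EuclideanSpace ℝ (Fin d) → ℝ) (i : Fin d)
    (y : EuclideanSpace ℝ (Fin d)) :
    partialD i (fun z => f (c • z)) y = c * partialD i f (c • y) := by
  rw [partialD, fderiv_comp_smul]
  simp [partialD]

lemma partialD_const_mul (c : ℝ) (f : EuclideanSpace ℝ (Fin d) → ℝ) (i : Fin d)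
    (y : EuclideanSpace ℝ (Fin d)) :
    partialD i (fun z => c * f z) y = c * partialD i f y := by
  have : (fun z => c * f z) = c • f := by ext; simp
  rw [partialD, this, fderiv_const_smul_field]
  simp [partialD]

lemma exp_smul_mem_ball {s : ℝ} {y : EuclideanSpace ℝ (Fin d)} :
    Real.exp s • y ∈ ball 0 ρ ↔ y ∈ ball 0 (Real.exp (-s) * ρ) := by
  rw [mem_ball_zero_iff, mem_ball_zero_iff, norm_smul, Real.norm_of_nonneg (Real.exp_pos s).le,
    Real.exp_neg, lt_inv_mul_iff₀ (Real.exp_pos s)]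

lemma IsZeroExtension.comp_dilate (hu : IsZeroExtension D ρ u) (s : ℝ) :
    IsZeroExtension ((fun y => Real.exp s • y) ⁻¹' D) (Real.exp (-s) * ρ) (dilate u s) where
  isOpen := hu.isOpen.preimage (by fun_prop)
  continuousOn := hu.continuousOn.comp (by fun_prop) fun _ hy => exp_smul_mem_ball.2 hy
  eq_zero y hy hyD := hu.eq_zero _ (exp_smul_mem_ball.2 hy) hyD
  contDiffOn := hu.contDiffOn.comp (by fun_prop) fun _ hy => hy
  laplace y hy := by
    have h1 : ∀ i, partialD i (dilate u s) =
        fun z => Real.exp s * partialD i u (Real.exp s • z) := fun i =>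
      funext fun z => partialD_comp_smul _ _ _ _
    have h2 : ∀ i, partialD i (partialD i (dilate u s)) y =
        Real.exp s * Real.exp s * partialD i (partialD i u) (Real.exp s • y) := fun i => by
      rw [h1, partialD_const_mul, partialD_comp_smul, mul_assoc]
    rw [Finset.sum_congr rfl fun i _ => h2 i, ← Finset.mul_sum, hu.laplace _ hy, mul_zero]

lemma IsZeroExtension.mono (hu : IsZeroExtension D ρ u) {ρ' : ℝ} (h : ρ' ≤ ρ) :
    IsZeroExtension D ρ' u :=
  { hu with
    continuousOn := hu.continuousOn.mono (ball_subset_ball h)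
    eq_zero := fun y hy => hu.eq_zero y (ball_subset_ball h hy) }

lemma one_lt_exp_neg_mul {s : ℝ} (hs : Real.exp s < ρ) : 1 < Real.exp (-s) * ρ := by
  rw [Real.exp_neg, lt_inv_mul_iff₀ (Real.exp_pos s), mul_one]
  exact hs

lemma integral_mul_dilate_sq (p : ℝ → ℝ) (u : EuclideanSpace ℝ (Fin d) → ℝ) (s : ℝ) :
    ∫ y, p (‖y‖ ^ 2) * dilate u s y ^ 2 =
      Real.exp (-(d * s)) * ∫ z, p (Real.exp (-(2 * s)) * ‖z‖ ^ 2) * u z ^ 2 := by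
  have h := Measure.integral_comp_smul volume
    (fun z : EuclideanSpace ℝ (Fin d) => p (Real.exp (-(2 * s)) * ‖z‖ ^ 2) * u z ^ 2) (Real.exp s)
  have h1 : ∀ y : EuclideanSpace ℝ (Fin d),
      Real.exp (-(2 * s)) * ‖Real.exp s • y‖ ^ 2 = ‖y‖ ^ 2 := fun y => by
    rw [norm_smul, Real.norm_of_nonneg (Real.exp_pos s).le, mul_pow, ← mul_assoc,
      ← Real.exp_nat_mul,
      ← Real.exp_add]
    simp
  simp only [h1, finrank_euclideanSpace, Fintype.card_fin, ← Real.exp_nat_mul] at h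
  rw [← Real.exp_neg, abs_of_pos (Real.exp_pos _), smul_eq_mul] at h
  exact h

lemma IsRadialWeight.exists_bound (hω : IsRadialWeight ω ω' θ) :
    ∃ C, ∀ σ, 0 ≤ σ → |2 * σ * ω' σ| ≤ C := by
  have hc : ContinuousOn (fun σ => 2 * σ * ω' σ) (Icc 0 1) :=
    ((continuous_const.mul continuous_id).mul hω.continuous_deriv).continuousOn
  obtain ⟨C, hC⟩ := isCompact_Icc.exists_bound_of_continuousOn hc
  refine ⟨|C|, fun σ hσ => ?_⟩
  by_cases h1 : σ ≤ 1
  · exact (hC σ ⟨hσ, h1⟩).trans (le_abs_self C)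
  · rw [hω.deriv_eq_zero σ (not_le.1 h1), mul_zero, abs_zero]
    exact abs_nonneg _

lemma IsZeroExtension.hasDerivAt_weightedMean (hω : IsRadialWeight ω ω' θ)
    (hu : IsZeroExtension D ρ u) {s : ℝ} (hs : Real.exp s < ρ) :
    HasDerivAt (weightedMean ω u) (radialForm ω ω' (dilate u s)) s := by
  obtain ⟨c, hc, hcρ⟩ : ∃ c, s < c ∧ Real.exp c < ρ := by
    have h1 : s < Real.log ρ := (Real.lt_log_iff_exp_lt ((Real.exp_pos s).trans hs)).2 hs
    obtain ⟨c, h2, h3⟩ := exists_between h1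
    exact ⟨c, h2, (Real.lt_log_iff_exp_lt ((Real.exp_pos s).trans hs)).1 h3⟩
  set S : Set (EuclideanSpace ℝ (Fin d)) := closedBall 0 (Real.exp c) with hS
  have hScomp : IsCompact S := isCompact_closedBall _ _
  have hSsub : S ⊆ ball 0 ρ := closedBall_subset_ball hcρ
  have hucont : ContinuousOn u S := hu.continuousOn.mono hSsub
  have hone : ∀ r < c, ∀ z, z ∉ S → 1 < Real.exp (-(2 * r)) * ‖z‖ ^ 2 := by
    intro r hr z hz
    have hz' : Real.exp c < ‖z‖ := by simpa [hS] using hz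
    have h1 : Real.exp (2 * r) < ‖z‖ ^ 2 := by
      calc Real.exp (2 * r) < Real.exp (2 * c) := Real.exp_lt_exp.2 (by linarith)
        _ = Real.exp c ^ 2 := by rw [← Real.exp_nat_mul]; simp
        _ ≤ ‖z‖ ^ 2 := by gcongr
    rw [Real.exp_neg, lt_inv_mul_iff₀ (Real.exp_pos _), mul_one]
    exact h1
  have hmeas : ∀ p : ℝ → ℝ, Continuous p → ∀ r, ContinuousOn
      (fun z : EuclideanSpace ℝ (Fin d) => p (Real.exp (-(2 * r)) * ‖z‖ ^ 2) * u z ^ 2) S :=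
    fun p hp r => (hp.comp (by fun_prop)).continuousOn.mul (hucont.pow 2)
  have hcω' : Continuous fun σ => -(2 * σ * ω' σ) :=
    ((continuous_const.mul continuous_id).mul hω.continuous_deriv).neg
  obtain ⟨C, hC⟩ := hω.exists_bound
  have hder : HasDerivAt (fun r => ∫ z in S, ω (Real.exp (-(2 * r)) * ‖z‖ ^ 2) * u z ^ 2)
      (∫ z in S, -(2 * (Real.exp (-(2 * s)) * ‖z‖ ^ 2) * ω' (Real.exp (-(2 * s)) * ‖z‖ ^ 2))
        * u z ^ 2) s := by
    refine (hasDerivAt_integral_of_dominated_loc_of_deriv_le (s := univ)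
      (F := fun r z => ω (Real.exp (-(2 * r)) * ‖z‖ ^ 2) * u z ^ 2)
      (F' := fun r z => -(2 * (Real.exp (-(2 * r)) * ‖z‖ ^ 2) * ω' (Real.exp (-(2 * r)) * ‖z‖ ^ 2))
        * u z ^ 2)
      (bound := fun z => C * u z ^ 2) univ_mem
      (Eventually.of_forall fun r => ?_) ?_ ?_ ?_ ?_ ?_).2
    · exact (hmeas ω hω.contDiff.continuous r).aestronglyMeasurable hScomp.measurableSet
    · exact (hmeas ω hω.contDiff.continuous s).integrableOn_compact hScomp
    · exact (hmeas _ hcω' s).aestronglyMeasurable hScomp.measurableSet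
    · refine Eventually.of_forall fun z r _ => ?_
      rw [norm_mul, norm_neg, Real.norm_eq_abs, Real.norm_of_nonneg (sq_nonneg (u z))]
      exact mul_le_mul_of_nonneg_right (hC _ (by positivity)) (sq_nonneg _)
    · exact (continuousOn_const.mul (hucont.pow 2)).integrableOn_compact hScomp
    · refine Eventually.of_forall fun z r _ => ?_
      have h1 : HasDerivAt (fun r : ℝ => Real.exp (-(2 * r)) * ‖z‖ ^ 2)
          (Real.exp (-(2 * r)) * (-2) * ‖z‖ ^ 2) r := by
        have : HasDerivAt (fun r : ℝ => -(2 * r)) (-2) r := by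
          simpa using (hasDerivAt_id r).const_mul (-2 : ℝ)
        exact this.exp.mul_const _
      have h2 := ((hω.hasDerivAt (Real.exp (-(2 * r)) * ‖z‖ ^ 2)).comp r h1).mul_const (u z ^ 2)
      convert! h2 using 1
      ring
  have hext : ∀ p : ℝ → ℝ, (∀ σ, 1 < σ → p σ = 0) → ∀ r < c,
      ∫ z in S, p (Real.exp (-(2 * r)) * ‖z‖ ^ 2) * u z ^ 2 =
      ∫ z, p (Real.exp (-(2 * r)) * ‖z‖ ^ 2) * u z ^ 2 := fun p hp r hr =>
    setIntegral_eq_integral_of_forall_compl_eq_zero fun z hz => by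
      rw [hp _ (hone r hr z hz), zero_mul]
  have hneg : HasDerivAt (fun r : ℝ => -((d : ℝ) * r)) (-d) s := by
    simpa using (hasDerivAt_id s).const_mul (-(d : ℝ))
  have hprod := hneg.exp.mul hder
  have heq : weightedMean ω u =ᶠ[𝓝 s] fun r => Real.exp (-(d * r)) *
      ∫ z in S, ω (Real.exp (-(2 * r)) * ‖z‖ ^ 2) * u z ^ 2 := by
    filter_upwards [Iio_mem_nhds hc] with r hr
    rw [hext ω hω.eq_zero r hr, weightedMean, integral_mul_dilate_sq]
  refine (hprod.congr_of_eventuallyEq heq).congr_deriv ?_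
  have hform := integral_mul_dilate_sq (fun σ => d * ω σ + 2 * σ * ω' σ) u s
  rw [radialForm, hform, ← hext (fun σ => d * ω σ + 2 * σ * ω' σ)
    (fun σ hσ => by rw [hω.eq_zero σ hσ, hω.deriv_eq_zero σ hσ]; simp) s hc]
  have hi1 := (hmeas ω hω.contDiff.continuous s).integrableOn_compact (μ := volume) hScomp
  have hi2 := (hmeas _ hcω' s).integrableOn_compact (μ := volume) hScomp
  have hsplit : ∫ z in S, (d * ω (Real.exp (-(2 * s)) * ‖z‖ ^ 2)
        + 2 * (Real.exp (-(2 * s)) * ‖z‖ ^ 2) * ω' (Real.exp (-(2 * s)) * ‖z‖ ^ 2)) * u z ^ 2 =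
      d * (∫ z in S, ω (Real.exp (-(2 * s)) * ‖z‖ ^ 2) * u z ^ 2)
      - ∫ z in S, -(2 * (Real.exp (-(2 * s)) * ‖z‖ ^ 2) * ω' (Real.exp (-(2 * s)) * ‖z‖ ^ 2))
        * u z ^ 2 := by
    rw [← integral_const_mul, ← integral_sub (hi1.const_mul _) hi2]
    refine integral_congr_ae (Eventually.of_forall fun z => ?_)
    simp only
    ring
  rw [hsplit]
  ring

end Dilation

section Comparison

variable {d : ℕ} {D : Set (EuclideanSpace ℝ (Fin d))} {ρ ε a t : ℝ}
  {u : EuclideanSpace ℝ (Fin d) → ℝ} {ω ω' θ : ℝ → ℝ}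

/-- The weighted pairing of a truncation of the dilation by `exp t` with the dilation by
`exp s`. -/
def truncPairing (ω : ℝ → ℝ) (ε : ℝ) (u : EuclideanSpace ℝ (Fin d) → ℝ) (t s : ℝ) : ℝ :=
  ∫ y, ω (‖y‖ ^ 2) * trunc ε (dilate u t y) * dilate u s y

lemma fderiv_dilate_apply_self (u : EuclideanSpace ℝ (Fin d) → ℝ) (s : ℝ)
    (y : EuclideanSpace ℝ (Fin d)) :
    fderiv ℝ (dilate u s) y y = fderiv ℝ u (Real.exp s • y) (Real.exp s • y) := by
  have : dilate u s = fun z => u (Real.exp s • z) := rfl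
  rw [this, fderiv_comp_smul]
  simp

lemma exp_smul_mem_of_le (hstar : ∀ y ∈ D, ∀ c : ℝ, 0 < c → c ≤ 1 → c • y ∈ D) {s : ℝ}
    (hst : s ≤ t) {y : EuclideanSpace ℝ (Fin d)} (hy : Real.exp t • y ∈ D) :
    Real.exp s • y ∈ D := by
  have := hstar _ hy (Real.exp (s - t)) (Real.exp_pos _) (Real.exp_le_one_iff.2 (by linarith))
  rwa [smul_smul, ← Real.exp_add, sub_add_cancel] at this

lemma IsZeroExtension.comp_dilate_of_le (hu : IsZeroExtension D ρ u) (hρ : 0 < ρ) {s : ℝ}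
    (hst : s ≤ t) : IsZeroExtension ((fun y => Real.exp s • y) ⁻¹' D) (Real.exp (-t) * ρ)
      (dilate u s) :=
  (hu.comp_dilate s).mono (by gcongr)

lemma IsZeroExtension.continuous_truncWeight (hω : IsRadialWeight ω ω' θ)
    (hu : IsZeroExtension D ρ u) (ht : Real.exp t < ρ) :
    Continuous fun y => ω (‖y‖ ^ 2) * trunc ε (dilate u t y) :=
  continuous_mul_of_vanishing (one_lt_exp_neg_mul ht)
    (hω.contDiff.continuous.comp (by fun_prop))
    (fun _ hy => hω.eq_zero _ (one_lt_sq_norm hy))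
    ((continuous_trunc ε).comp_continuousOn (hu.comp_dilate t).continuousOn)

lemma IsZeroExtension.hasDerivAt_truncPairing (hω : IsRadialWeight ω ω' θ)
    (hu : IsZeroExtension D ρ u)
    (hstar : ∀ y ∈ D, ∀ c : ℝ, 0 < c → c ≤ 1 → c • y ∈ D) (hε : 0 < ε)
    (ht : Real.exp t < ρ) {s₀ : ℝ} (hs₀ : s₀ < t) :
    HasDerivAt (truncPairing ω ε u t)
      (∫ y, ω (‖y‖ ^ 2) * trunc ε (dilate u t y) * fderiv ℝ (dilate u s₀) y y) s₀ := by
  have hρ0 : 0 < ρ := (Real.exp_pos t).trans ht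
  have hρ1 := one_lt_exp_neg_mul ht
  obtain ⟨a, ha⟩ : ∃ a, a < s₀ := exists_lt s₀
  have hw := hu.continuous_truncWeight (ε := ε) hω ht
  have hw0 : ∀ y : EuclideanSpace ℝ (Fin d), 1 < ‖y‖ →
      ω (‖y‖ ^ 2) * trunc ε (dilate u t y) = 0 := fun y hy => by
    rw [hω.eq_zero _ (one_lt_sq_norm hy), zero_mul]
  set K : Set (EuclideanSpace ℝ (Fin d)) := closedBall 0 1 ∩ {y | ε ≤ |dilate u t y|} with hK
  have hKw : ∀ y, y ∉ K → ω (‖y‖ ^ 2) * trunc ε (dilate u t y) = 0 := fun y hy => by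
    by_cases h1 : 1 < ‖y‖
    · exact hw0 y h1
    · have h2 : |dilate u t y| ≤ ε := by
        by_contra h3
        exact hy ⟨by simpa using h1, (not_le.1 h3).le⟩
      rw [trunc_eq_zero hε h2, mul_zero]
  have hKball : K ⊆ ball 0 (Real.exp (-t) * ρ) :=
    inter_subset_left.trans (closedBall_subset_ball hρ1)
  have hKD : ∀ y ∈ K, Real.exp t • y ∈ D := fun y hy => by
    by_contra h1
    have h2 := hu.eq_zero _ (exp_smul_mem_ball.2 (hKball hy)) h1
    have h3 : ε ≤ |u (Real.exp t • y)| := hy.2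
    rw [h2, abs_zero] at h3
    linarith
  have hKc : IsCompact K := by
    refine (isCompact_closedBall _ _).of_isClosed_subset ?_ inter_subset_left
    have hc := ((hu.comp_dilate t).continuousOn.mono (closedBall_subset_ball hρ1)).abs
    exact hc.preimage_isClosed_of_isClosed isClosed_closedBall isClosed_Ici
  have hsmul : ContinuousOn (fun p : ℝ × EuclideanSpace ℝ (Fin d) => Real.exp p.1 • p.2)
      (Icc a t ×ˢ K) := Continuous.continuousOn (by fun_prop)
  have hmaps : MapsTo (fun p : ℝ × EuclideanSpace ℝ (Fin d) => Real.exp p.1 • p.2)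
      (Icc a t ×ˢ K) D := fun p hp => exp_smul_mem_of_le hstar hp.1.2 (hKD _ hp.2)
  have hfd : ContinuousOn (fun p : ℝ × EuclideanSpace ℝ (Fin d) =>
      fderiv ℝ u (Real.exp p.1 • p.2) (Real.exp p.1 • p.2)) (Icc a t ×ˢ K) :=
    ((hu.contDiffOn.continuousOn_fderiv_of_isOpen hu.isOpen (by norm_num)).comp hsmul
      hmaps).clm_apply hsmul
  obtain ⟨C, hC⟩ := (isCompact_Icc.prod hKc).exists_bound_of_continuousOn hfd
  have hmeas : ∀ s ≤ t, Integrable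
      fun y => ω (‖y‖ ^ 2) * trunc ε (dilate u t y) * dilate u s y := fun s hs =>
    integrable_mul_of_vanishing hρ1 hw hw0 (hu.comp_dilate_of_le hρ0 hs).continuousOn
  refine (hasDerivAt_integral_of_dominated_loc_of_deriv_le (s := Ioo a t)
    (F := fun s y => ω (‖y‖ ^ 2) * trunc ε (dilate u t y) * dilate u s y)
    (F' := fun s y => ω (‖y‖ ^ 2) * trunc ε (dilate u t y) * fderiv ℝ (dilate u s) y y)
    (bound := fun y => ‖ω (‖y‖ ^ 2) * trunc ε (dilate u t y)‖ * C) (Ioo_mem_nhds ha hs₀)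
    ?_ (hmeas s₀ hs₀.le) ?_ ?_ ?_ ?_).2
  · filter_upwards [Iio_mem_nhds hs₀] with s hs using (hmeas s (le_of_lt hs)).1
  · exact ((hu.comp_dilate_of_le hρ0 hs₀.le).integrable_flux hω (hu.comp_dilate t)
      (fun y hy => exp_smul_mem_of_le hstar hs₀.le hy) hρ1 hε).1
  · refine Eventually.of_forall fun y s hs => ?_
    rw [norm_mul, fderiv_dilate_apply_self]
    by_cases hy : y ∈ K
    · exact mul_le_mul_of_nonneg_left (hC (s, y) ⟨Ioo_subset_Icc_self hs, hy⟩) (norm_nonneg _)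
    · rw [hKw y hy, norm_zero, zero_mul, zero_mul]
  · exact (hw.integrable_of_hasCompactSupport (hasCompactSupport_of_vanishing hw0)).norm.mul_const C
  · refine Eventually.of_forall fun y s hs => ?_
    by_cases hy : y ∈ K
    · refine HasDerivAt.const_mul _ ?_
      rw [fderiv_dilate_apply_self]
      have hD := exp_smul_mem_of_le hstar hs.2.le (hKD y hy)
      have h1 : HasFDerivAt u (fderiv ℝ u (Real.exp s • y)) (Real.exp s • y) :=
        ((hu.contDiffAt hD).differentiableAt (by norm_num)).hasFDerivAt
      exact h1.comp_hasDerivAt s ((Real.hasDerivAt_exp s).smul_const y)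
    · simp only [hKw y hy, zero_mul]
      exact hasDerivAt_const _ _

lemma IsZeroExtension.continuousOn_truncPairing (hω : IsRadialWeight ω ω' θ)
    (hu : IsZeroExtension D ρ u) (ht : Real.exp t < ρ) :
    ContinuousOn (truncPairing ω ε u t) (Iic t) := by
  have hρ0 : 0 < ρ := (Real.exp_pos t).trans ht
  have hρ1 := one_lt_exp_neg_mul ht
  have hw := hu.continuous_truncWeight (ε := ε) hω ht
  have hw0 : ∀ y : EuclideanSpace ℝ (Fin d), 1 < ‖y‖ →
      ω (‖y‖ ^ 2) * trunc ε (dilate u t y) = 0 := fun y hy => by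
    rw [hω.eq_zero _ (one_lt_sq_norm hy), zero_mul]
  have hmem : ∀ s ≤ t, ∀ y : EuclideanSpace ℝ (Fin d), ‖y‖ ≤ 1 →
      Real.exp s • y ∈ closedBall 0 (Real.exp t) := fun s hs y hy => by
    rw [mem_closedBall_zero_iff, norm_smul, Real.norm_of_nonneg (Real.exp_pos s).le]
    exact (mul_le_of_le_one_right (Real.exp_pos s).le hy).trans (Real.exp_le_exp.2 hs)
  obtain ⟨C, hC⟩ := (isCompact_closedBall (0 : EuclideanSpace ℝ (Fin d))
    (Real.exp t)).exists_bound_of_continuousOn (hu.continuousOn.mono (closedBall_subset_ball ht))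
  refine continuousOn_of_dominated (bound := fun y => ‖ω (‖y‖ ^ 2) * trunc ε (dilate u t y)‖ * C)
    (fun s hs => ?_) (fun s hs => ?_) ?_ ?_
  · exact (integrable_mul_of_vanishing hρ1 hw hw0 (hu.comp_dilate_of_le hρ0 hs).continuousOn).1
  · refine Eventually.of_forall fun y => ?_
    rw [norm_mul]
    by_cases hy : ‖y‖ ≤ 1
    · exact mul_le_mul_of_nonneg_left (hC _ (hmem s hs y hy)) (norm_nonneg _)
    · rw [hw0 y (not_le.1 hy), norm_zero, zero_mul, zero_mul]
  · exact (hw.integrable_of_hasCompactSupport (hasCompactSupport_of_vanishing hw0)).norm.mul_const C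
  · refine Eventually.of_forall fun y => ?_
    by_cases hy : ‖y‖ ≤ 1
    · refine continuousOn_const.mul (hu.continuousOn.comp (by fun_prop) fun s hs => ?_)
      exact closedBall_subset_ball ht (hmem s hs y hy)
    · simp only [hw0 y (not_le.1 hy), zero_mul]
      exact continuousOn_const

lemma IsZeroExtension.tendsto_truncPairing (hω : IsRadialWeight ω ω' θ)
    (hu : IsZeroExtension D ρ u) (ht : Real.exp t < ρ) {s : ℝ} (hst : s ≤ t) :
    Tendsto (fun n : ℕ => truncPairing ω (1 / ((n : ℝ) + 1)) u t s) atTop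
      (𝓝 (∫ y, ω (‖y‖ ^ 2) * dilate u t y * dilate u s y)) := by
  have hρ0 : 0 < ρ := (Real.exp_pos t).trans ht
  have hρ1 := one_lt_exp_neg_mul ht
  have hc := (hu.comp_dilate_of_le hρ0 hst).continuousOn
  have hct := (hu.comp_dilate t).continuousOn
  refine tendsto_integral_of_dominated_convergence
    (fun y => ω (‖y‖ ^ 2) * (|dilate u t y| * |dilate u s y|)) (fun n => ?_) ?_ (fun n => ?_) ?_
  · exact (integrable_mul_of_vanishing hρ1 (hu.continuous_truncWeight hω ht)
      (fun y hy => by rw [hω.eq_zero _ (one_lt_sq_norm hy), zero_mul]) hc).1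
  · exact integrable_mul_of_vanishing hρ1 (hω.contDiff.continuous.comp (by fun_prop))
      (fun y hy => hω.eq_zero _ (one_lt_sq_norm hy)) (hct.abs.mul hc.abs)
  · refine Eventually.of_forall fun y => ?_
    rw [norm_mul, norm_mul, Real.norm_of_nonneg (hω.nonneg _), mul_assoc]
    exact mul_le_mul_of_nonneg_left
      (mul_le_mul_of_nonneg_right (abs_trunc_le _ _) (abs_nonneg _)) (hω.nonneg _)
  · exact Eventually.of_forall fun y => ((tendsto_trunc _).const_mul _).mul_const _

lemma IsZeroExtension.comparison (hω : IsRadialWeight ω ω' θ)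
    (hu : IsZeroExtension D ρ u)
    (hstar : ∀ y ∈ D, ∀ c : ℝ, 0 < c → c ≤ 1 → c • y ∈ D)
    (hat : a ≤ t) (ht : Real.exp t < ρ) :
    3 * weightedMean ω u t + weightedMean ω u a
      - 4 * ∫ y, ω (‖y‖ ^ 2) * dilate u t y * dilate u a y ≤
      (t - a) * radialForm ω ω' (dilate u t) := by
  have hρ0 : 0 < ρ := (Real.exp_pos t).trans ht
  have hρ1 := one_lt_exp_neg_mul ht
  have key : ∀ ε, 0 < ε → 4 * truncPairing ω ε u t t - weightedMean ω u t
      - t * radialForm ω ω' (dilate u t) ≤ 4 * truncPairing ω ε u t a - weightedMean ω u a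
      - a * radialForm ω ω' (dilate u t) := by
    intro ε hε
    have hder : ∀ s ≤ t, HasDerivAt (weightedMean ω u) (radialForm ω ω' (dilate u s)) s :=
      fun s hs => hu.hasDerivAt_weightedMean hω ((Real.exp_le_exp.2 hs).trans_lt ht)
    have hJ : ∀ s < t, HasDerivAt (fun s => 4 * truncPairing ω ε u t s - weightedMean ω u s
        - s * radialForm ω ω' (dilate u t))
        (4 * (∫ y, ω (‖y‖ ^ 2) * trunc ε (dilate u t y) * fderiv ℝ (dilate u s) y y)
          - radialForm ω ω' (dilate u s) - 1 * radialForm ω ω' (dilate u t)) s := fun s hs =>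
      (((hu.hasDerivAt_truncPairing hω hstar hε ht hs).const_mul 4).sub (hder s hs.le)).sub
        ((hasDerivAt_id s).mul_const _)
    refine antitoneOn_of_deriv_nonpos (convex_Icc a t)
      (f := fun s => 4 * truncPairing ω ε u t s - weightedMean ω u s
        - s * radialForm ω ω' (dilate u t)) ?_ ?_ ?_ (left_mem_Icc.2 hat) (right_mem_Icc.2 hat) hat
    · refine ((continuousOn_const.mul ((hu.continuousOn_truncPairing hω ht).mono
        Icc_subset_Iic_self)).sub fun s hs => ?_).sub (by fun_prop)
      exact (hder s hs.2).continuousAt.continuousWithinAt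
    · rw [interior_Icc]
      exact fun s hs => (hJ s hs.2).differentiableAt.differentiableWithinAt
    · rw [interior_Icc]
      intro s hs
      rw [(hJ s hs.2).deriv]
      have := (hu.comp_dilate_of_le hρ0 hs.2.le).four_mul_integral_le hω (hu.comp_dilate t)
        (fun y hy => exp_smul_mem_of_le hstar hs.2.le hy) hρ1 hε
      linarith
  have h1 := hu.tendsto_truncPairing hω ht le_rfl
  have h2 := hu.tendsto_truncPairing hω ht hat
  have h3 : ∫ y, ω (‖y‖ ^ 2) * dilate u t y * dilate u t y = weightedMean ω u t := by
    simp only [weightedMean, pow_two, mul_assoc]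
  rw [h3] at h1
  have := le_of_tendsto_of_tendsto' (((h1.const_mul 4).sub_const (weightedMean ω u t)).sub_const
    (t * radialForm ω ω' (dilate u t))) (((h2.const_mul 4).sub_const (weightedMean ω u a)).sub_const
    (a * radialForm ω ω' (dilate u t))) fun n => key _ Nat.one_div_pos_of_nat
  linarith

lemma IsZeroExtension.comparison_of_pos (hω : IsRadialWeight ω ω' θ)
    (hu : IsZeroExtension D ρ u)
    (hstar : ∀ y ∈ D, ∀ c : ℝ, 0 < c → c ≤ 1 → c • y ∈ D)
    (hat : a ≤ t) (ht : Real.exp t < ρ) {c : ℝ} (hc : 0 < c) :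
    (3 - 2 * c) * weightedMean ω u t + (1 - 2 / c) * weightedMean ω u a ≤
      (t - a) * radialForm ω ω' (dilate u t) := by
  have hρ0 : 0 < ρ := (Real.exp_pos t).trans ht
  have hρ1 := one_lt_exp_neg_mul ht
  have hca := (hu.comp_dilate_of_le hρ0 hat).continuousOn
  have hct := (hu.comp_dilate t).continuousOn
  have hint : ∀ v : EuclideanSpace ℝ (Fin d) → ℝ, ContinuousOn v (ball 0 (Real.exp (-t) * ρ)) →
      Integrable fun y => ω (‖y‖ ^ 2) * v y := fun v hv =>
    integrable_mul_of_vanishing hρ1 (hω.contDiff.continuous.comp (by fun_prop))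
      (fun y hy => hω.eq_zero _ (one_lt_sq_norm hy)) hv
  have h1 : Integrable fun y => ω (‖y‖ ^ 2) * dilate u t y ^ 2 := hint _ (hct.pow 2)
  have h2 : Integrable fun y => ω (‖y‖ ^ 2) * dilate u a y ^ 2 := hint _ (hca.pow 2)
  have h3 : ∫ y, ω (‖y‖ ^ 2) * dilate u t y * dilate u a y ≤
      ∫ y, (c / 2 * (ω (‖y‖ ^ 2) * dilate u t y ^ 2)
        + 1 / (2 * c) * (ω (‖y‖ ^ 2) * dilate u a y ^ 2)) := by
    refine integral_mono ?_ ((h1.const_mul _).add (h2.const_mul _)) fun y => ?_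
    · simp only [mul_assoc]
      exact hint _ (hct.mul hca)
    · have h4 : c / 2 * dilate u t y ^ 2 + 1 / (2 * c) * dilate u a y ^ 2
          - dilate u t y * dilate u a y = (c * dilate u t y - dilate u a y) ^ 2 / (2 * c) := by
        field_simp
        ring
      have h5 : 0 ≤ (c * dilate u t y - dilate u a y) ^ 2 / (2 * c) := by positivity
      have h6 := mul_nonneg (hω.nonneg (‖y‖ ^ 2)) (h4 ▸ h5)
      simp only
      linarith
  rw [integral_add (h1.const_mul _) (h2.const_mul _), integral_const_mul, integral_const_mul] at h3
  have h4 := hu.comparison hω hstar hat ht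
  have h5 : c / 2 * weightedMean ω u t + 1 / (2 * c) * weightedMean ω u a
      = (2 * c * weightedMean ω u t + 2 / c * weightedMean ω u a) / 4 := by
    field_simp
    ring
  have h6 : ∫ y, ω (‖y‖ ^ 2) * dilate u t y * dilate u a y ≤
      (2 * c * weightedMean ω u t + 2 / c * weightedMean ω u a) / 4 := h5 ▸ h3
  linarith

end Comparison

section LogConvexity

lemma two_mul_sub_pow_three_le {z : ℝ} (h0 : 0 ≤ z) (h1 : z ≤ 2) :
    2 * z - z ^ 3 ≤ 3 + Real.exp (-z) ^ 2 - 4 * Real.exp (-z) := by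
  have h2 : Real.exp (-z) ≤ 1 - z + z ^ 2 / 2 := by
    have h3 := Real.quadratic_le_exp_of_nonneg h0
    have h4 : (1 - z + z ^ 2 / 2) * (1 + z + z ^ 2 / 2) ≥ 1 := by nlinarith [pow_nonneg h0 4]
    have h5 : 0 < 1 - z + z ^ 2 / 2 := by nlinarith [sq_nonneg (z - 1)]
    rw [Real.exp_neg, inv_le_iff_one_le_mul₀ (Real.exp_pos z)]
    nlinarith
  have h3 : 0 ≤ z - z ^ 2 / 2 := by nlinarith
  have h5 : z - z ^ 2 / 2 ≤ 1 - Real.exp (-z) := by linarith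
  have h6 : (z - z ^ 2 / 2) ^ 2 ≤ (1 - Real.exp (-z)) ^ 2 := pow_le_pow_left₀ h3 h5 2
  nlinarith [pow_nonneg h0 4]

lemma exists_cube_lt {S ε δ : ℝ} (hS0 : 0 ≤ S) (hε : 0 < ε) (hδ : 0 < δ) :
    ∃ x, 0 < x ∧ x ≤ δ ∧ (x * S + ε * x ^ 2) / 2 ≤ 2 ∧
      ((x * S + ε * x ^ 2) / 2) ^ 3 < ε * x ^ 2 := by
  set A : ℝ := S + ε + 1 with hA
  have hA1 : 1 ≤ A := by linarith
  set x : ℝ := min (min 1 (δ)) (min (1 / A) (ε / A ^ 3)) with hxdef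
  have hx0 : 0 < x := by
    refine lt_min (lt_min one_pos hδ) (lt_min (by positivity) (by positivity))
  have hx1 : x ≤ 1 := (min_le_left _ _).trans (min_le_left _ _)
  have hxp : x ≤ δ := (min_le_left _ _).trans (min_le_right _ _)
  have hxA : x * A ≤ 1 :=
    (le_div_iff₀ (by positivity)).1 ((min_le_right _ _).trans (min_le_left _ _))
  have hxε : x * A ^ 3 ≤ ε :=
    (le_div_iff₀ (by positivity)).1 ((min_le_right _ _).trans (min_le_right _ _))
  have hzle : (x * S + ε * x ^ 2) / 2 ≤ x * A / 2 := by
    have : ε * x ^ 2 ≤ ε * x := by nlinarith [mul_pos hε hx0]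
    rw [hA]
    nlinarith
  refine ⟨x, hx0, hxp, by linarith, ?_⟩
  have h2 : ((x * S + ε * x ^ 2) / 2) ^ 3 ≤ (x * A / 2) ^ 3 :=
    pow_le_pow_left₀ (by positivity) hzle 3
  have h3 : (x * A / 2) ^ 3 = x ^ 2 * (x * A ^ 3) / 8 := by ring
  have h4 : x ^ 2 * (x * A ^ 3) ≤ x ^ 2 * ε := mul_le_mul_of_nonneg_left hxε (sq_nonneg x)
  have h5 : 0 < ε * x ^ 2 := by positivity
  nlinarith

/-- A one-sided difference inequality that forces `log F` to lie below its chords. -/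
lemma log_le_chord {F F' : ℝ → ℝ} {p b q : ℝ} (hpb : p < b) (hbq : b < q)
    (hF : ∀ t ∈ Icc p q, HasDerivAt F (F' t) t) (hpos : ∀ t ∈ Icc p q, 0 < F t)
    (hF' : ∀ t ∈ Icc p q, 0 ≤ F' t)
    (hcmp : ∀ t ∈ Icc p q, ∀ a ∈ Icc p t, ∀ c : ℝ, 0 < c →
      (3 - 2 * c) * F t + (1 - 2 / c) * F a ≤ (t - a) * F' t) :
    (q - p) * Real.log (F b) ≤ (q - b) * Real.log (F p) + (b - p) * Real.log (F q) := by
  by_contra! hcon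
  have hpq : 0 < q - p := by linarith
  set L : ℝ := (Real.log (F q) - Real.log (F p)) / (q - p) with hL
  have hLmul : L * (q - p) = Real.log (F q) - Real.log (F p) := div_mul_cancel₀ _ hpq.ne'
  set m : ℝ := Real.log (F b) - Real.log (F p) - L * (b - p) with hm
  have hm0 : 0 < m := by
    have : 0 < m * (q - p) := by
      have : m * (q - p) = (q - p) * Real.log (F b)
        - ((q - b) * Real.log (F p) + (b - p) * Real.log (F q)) := by
        rw [hm]
        linear_combination (-(b - p)) * hLmul
      linarith
    exact pos_of_mul_pos_left this hpq.le
  obtain ⟨ε, hε, hεm⟩ : ∃ ε : ℝ, 0 < ε ∧ ε * ((b - p) * (q - b)) < m := by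
    have h1 : 0 < (b - p) * (q - b) := mul_pos (by linarith) (by linarith)
    refine ⟨m / (2 * ((b - p) * (q - b))), by positivity, ?_⟩
    rw [div_mul_eq_mul_div, div_lt_iff₀ (by positivity)]
    nlinarith
  set k : ℝ → ℝ := fun s => Real.log (F s) - Real.log (F p) - L * (s - p) + ε * ((s - p) * (s - q))
    with hk
  have hkd : ∀ t ∈ Icc p q, HasDerivAt k (F' t / F t - L + ε * (2 * t - p - q)) t := by
    intro t ht
    have h1 := (hF t ht).log (hpos t ht).ne'
    have h2 : HasDerivAt (fun s => L * (s - p)) L t := by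
      simpa using ((hasDerivAt_id t).sub_const p).const_mul L
    have h3 := ((((hasDerivAt_id t).sub_const p).mul ((hasDerivAt_id t).sub_const q)).const_mul ε)
    refine (((h1.sub_const (Real.log (F p))).sub h2).add h3).congr_deriv ?_
    simp only [id]
    ring
  have hkc : ContinuousOn k (Icc p q) := fun t ht => (hkd t ht).continuousAt.continuousWithinAt
  obtain ⟨c, hc, hmax⟩ := isCompact_Icc.exists_isMaxOn (nonempty_Icc.2 (by linarith)) hkc
  have hkb : 0 < k b := by
    have : k b = m - ε * ((b - p) * (q - b)) := by simp only [hk, hm]; ring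
    linarith
  have hkc0 : 0 < k c := hkb.trans_le (hmax ⟨hpb.le, hbq.le⟩)
  have hkp : k p = 0 := by simp [hk]
  have hkq : k q = 0 := by simp only [hk]; linear_combination -hLmul
  have hcp : p < c := lt_of_le_of_ne hc.1 (by rintro rfl; linarith)
  have hcq : c < q := lt_of_le_of_ne hc.2 (by rintro rfl; linarith)
  have hloc : IsLocalMax k c := hmax.isLocalMax (Icc_mem_nhds hcp hcq)
  have hd0 := hloc.hasDerivAt_eq_zero (hkd c hc)
  have hFc := hpos c hc
  set S : ℝ := F' c / F c with hS
  have hS0 : 0 ≤ S := div_nonneg (hF' c hc) hFc.le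
  have hSF : F' c = S * F c := (div_mul_cancel₀ _ hFc.ne').symm
  have hx : ∀ x, 0 ≤ x → x ≤ c - p → (x * S + ε * x ^ 2) / 2 ≤ 2 →
      ε * x ^ 2 ≤ ((x * S + ε * x ^ 2) / 2) ^ 3 := by
    intro x hx0 hxp hz2
    set z : ℝ := (x * S + ε * x ^ 2) / 2 with hz
    have hz0 : 0 ≤ z := by positivity
    have ha : c - x ∈ Icc p q := ⟨by linarith, by linarith⟩
    have hlog : Real.log (F (c - x)) ≤ Real.log (F c) - 2 * z := by
      have h1 : k (c - x) ≤ k c := hmax ha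
      have h2 : S = L - ε * (2 * c - p - q) := by linarith
      simp only [hk] at h1
      rw [hz, h2]
      nlinarith
    have hFa : F (c - x) ≤ Real.exp (-z) ^ 2 * F c := by
      rw [← Real.log_le_log_iff (hpos _ ha) (by positivity), Real.log_mul (by positivity) hFc.ne',
        Real.log_pow, Real.log_exp]
      push_cast
      linarith
    have h1 := hcmp c hc (c - x) ⟨ha.1, by linarith⟩ (Real.exp (-z)) (Real.exp_pos _)
    have he1 : Real.exp (-z) ≤ 1 := Real.exp_le_one_iff.2 (by linarith)
    have he0 := Real.exp_pos (-z)
    have h2 : (1 - 2 / Real.exp (-z)) * (Real.exp (-z) ^ 2 * F c) ≤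
        (1 - 2 / Real.exp (-z)) * F (c - x) := by
      refine mul_le_mul_of_nonpos_left hFa ?_
      have : 1 ≤ 2 / Real.exp (-z) := by rw [le_div_iff₀ he0]; linarith
      linarith
    have h3 : (1 - 2 / Real.exp (-z)) * (Real.exp (-z) ^ 2 * F c) =
        (Real.exp (-z) ^ 2 - 2 * Real.exp (-z)) * F c := by
      field_simp
    have h4 : (3 + Real.exp (-z) ^ 2 - 4 * Real.exp (-z)) * F c ≤ x * S * F c := by
      rw [h3] at h2
      rw [hSF] at h1
      linarith
    have h5 := le_of_mul_le_mul_right h4 hFc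
    have h6 := two_mul_sub_pow_three_le hz0 hz2
    linarith
  obtain ⟨x, hx0, hxp, hz2, hlt⟩ := exists_cube_lt hS0 hε (sub_pos.2 hcp)
  exact absurd (hx x hx0.le hxp hz2) hlt.not_ge

end LogConvexity

section Sharp

variable {d : ℕ} {D : Set (EuclideanSpace ℝ (Fin d))} {ρ : ℝ}
  {u : EuclideanSpace ℝ (Fin d) → ℝ} {ω ω' θ : ℝ → ℝ}

lemma IsZeroExtension.monotoneOn_weightedMean (hω : IsRadialWeight ω ω' θ)
    (hu : IsZeroExtension D ρ u) {q : ℝ} (hq : Real.exp q < ρ) :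
    MonotoneOn (weightedMean ω u) (Iic q) := by
  have hder : ∀ s ≤ q, HasDerivAt (weightedMean ω u) (radialForm ω ω' (dilate u s)) s :=
    fun s hs => hu.hasDerivAt_weightedMean hω ((Real.exp_le_exp.2 hs).trans_lt hq)
  refine monotoneOn_of_deriv_nonneg (convex_Iic q)
    (fun s hs => (hder s hs).continuousAt.continuousWithinAt) ?_ ?_
  · exact fun s hs =>
      (hder s (mem_Iic.1 (interior_subset hs))).differentiableAt.differentiableWithinAt
  · intro s hs
    have hs' : s ≤ q := mem_Iic.1 (interior_subset hs)
    rw [(hder s hs').deriv]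
    exact (hu.comp_dilate s).radialForm_nonneg hω
      (one_lt_exp_neg_mul ((Real.exp_le_exp.2 hs').trans_lt hq))

lemma IsZeroExtension.log_weightedMean_le_chord (hω : IsRadialWeight ω ω' θ)
    (hu : IsZeroExtension D ρ u)
    (hstar : ∀ y ∈ D, ∀ c : ℝ, 0 < c → c ≤ 1 → c • y ∈ D) {p b q : ℝ} (hpb : p < b) (hbq : b < q)
    (hq : Real.exp q < ρ) (hpos : 0 < weightedMean ω u p) :
    (q - p) * Real.log (weightedMean ω u b) ≤
      (q - b) * Real.log (weightedMean ω u p) + (b - p) * Real.log (weightedMean ω u q) := by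
  have hlt : ∀ t ∈ Icc p q, Real.exp t < ρ := fun t ht => (Real.exp_le_exp.2 ht.2).trans_lt hq
  exact log_le_chord hpb hbq (fun t ht => hu.hasDerivAt_weightedMean hω (hlt t ht))
    (fun t ht => hpos.trans_le
      (hu.monotoneOn_weightedMean hω hq (hpb.trans hbq).le ht.2 ht.1))
    (fun t ht => (hu.comp_dilate t).radialForm_nonneg hω (one_lt_exp_neg_mul (hlt t ht)))
    (fun t ht a ha c hc => hu.comparison_of_pos hω hstar ha.2 (hlt t ht) hc)

/-- Smooth approximations of the indicator function of `(-∞, 1)`. -/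
def cutoff (n : ℕ) (s : ℝ) : ℝ := Real.smoothTransition (n * (1 - s))

lemma cutoff_eq_zero (n : ℕ) {s : ℝ} (hs : 1 ≤ s) : cutoff n s = 0 :=
  Real.smoothTransition.zero_of_nonpos
    (mul_nonpos_of_nonneg_of_nonpos n.cast_nonneg (sub_nonpos.2 hs))

lemma isRadialWeight_cutoff (n : ℕ) :
    IsRadialWeight (cutoff n) (deriv (cutoff n)) (fun s => ∫ t in s..1, cutoff n t) := by
  have hc : ContDiff ℝ 1 (cutoff n) := Real.smoothTransition.contDiff.comp (by fun_prop)
  refine ⟨fun s => (hc.differentiable one_ne_zero s).hasDerivAt, hc.continuous_deriv le_rfl,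
    fun s => ?_, fun s => Real.smoothTransition.nonneg _, fun s => ?_,
    fun s hs => cutoff_eq_zero n hs.le, fun s hs => ?_, fun s hs => ?_⟩
  · exact intervalIntegral.integral_hasDerivAt_left (hc.continuous.intervalIntegrable _ _)
      (hc.continuous.stronglyMeasurableAtFilter _ _) hc.continuous.continuousAt
  · rcases le_total s 1 with hs | hs
    · exact intervalIntegral.integral_nonneg hs fun t _ => Real.smoothTransition.nonneg _
    · rw [intervalIntegral.integral_zero_ae]
      refine Eventually.of_forall fun t ht => cutoff_eq_zero n ?_
      rw [uIoc_of_ge hs] at ht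
      exact ht.1.le
  · have : cutoff n =ᶠ[𝓝 s] fun _ => 0 := by
      filter_upwards [Ioi_mem_nhds hs] with t ht using cutoff_eq_zero n (le_of_lt ht)
    rw [this.deriv_eq, deriv_const]
  · rw [intervalIntegral.integral_zero_ae]
    refine Eventually.of_forall fun t ht => cutoff_eq_zero n ?_
    rw [uIoc_of_ge hs.le] at ht
    exact ht.1.le

lemma tendsto_cutoff (s : ℝ) :
    Tendsto (fun n : ℕ => cutoff n s) atTop (𝓝 ((Iio 1).indicator (fun _ => 1) s)) := by
  by_cases hs : s < 1
  · rw [indicator_of_mem (mem_Iio.2 hs)]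
    obtain ⟨N, hN⟩ := exists_nat_gt (1 / (1 - s))
    refine tendsto_const_nhds.congr' ?_
    filter_upwards [eventually_ge_atTop N] with n hn
    have hn' : (N : ℝ) ≤ n := by exact_mod_cast hn
    refine (Real.smoothTransition.one_of_one_le ?_).symm
    exact ((div_lt_iff₀ (sub_pos.2 hs)).1 (hN.trans_le hn')).le
  · rw [indicator_of_notMem (by simpa using hs)]
    exact tendsto_const_nhds.congr fun n => (cutoff_eq_zero n (not_lt.1 hs)).symm

/-- The square mean of the dilations of `u` over the unit ball. -/
def ballMean (u : EuclideanSpace ℝ (Fin d) → ℝ) : ℝ → ℝ :=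
  weightedMean ((Iio 1).indicator fun _ => 1) u

lemma IsZeroExtension.tendsto_weightedMean_cutoff (hu : IsZeroExtension D ρ u) {s : ℝ}
    (hs : Real.exp s < ρ) :
    Tendsto (fun n => weightedMean (cutoff n) u s) atTop (𝓝 (ballMean u s)) := by
  have hρ1 := one_lt_exp_neg_mul hs
  have hc := (hu.comp_dilate s).continuousOn
  have hcl : ContinuousOn (fun y => dilate u s y ^ 2) (closedBall 0 1) :=
    (hc.mono (closedBall_subset_ball hρ1)).pow 2
  refine tendsto_integral_of_dominated_convergence
    ((closedBall 0 1).indicator fun y => dilate u s y ^ 2) (fun n => ?_) ?_ (fun n => ?_) ?_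
  · exact (integrable_mul_of_vanishing hρ1
      ((isRadialWeight_cutoff n).contDiff.continuous.comp (by fun_prop))
      (fun y hy => cutoff_eq_zero n (one_lt_sq_norm hy).le) (hc.pow 2)).1
  · exact (hcl.integrableOn_compact (isCompact_closedBall _ _)).integrable_indicator
      measurableSet_closedBall
  · refine Eventually.of_forall fun y => ?_
    by_cases hy : ‖y‖ ≤ 1
    · rw [indicator_of_mem (by simpa using hy), norm_mul, Real.norm_of_nonneg (sq_nonneg _),
        Real.norm_of_nonneg (show 0 ≤ cutoff n _ from Real.smoothTransition.nonneg _)]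
      exact mul_le_of_le_one_left (sq_nonneg _) (Real.smoothTransition.le_one _)
    · rw [cutoff_eq_zero n (one_lt_sq_norm (not_le.1 hy)).le, zero_mul, norm_zero]
      exact indicator_nonneg (fun _ _ => sq_nonneg _) _
  · exact Eventually.of_forall fun y => (tendsto_cutoff _).mul_const _

lemma IsZeroExtension.ballMean_mono (hu : IsZeroExtension D ρ u) {p q : ℝ} (hpq : p ≤ q)
    (hq : Real.exp q < ρ) : ballMean u p ≤ ballMean u q :=
  le_of_tendsto_of_tendsto'
    (hu.tendsto_weightedMean_cutoff ((Real.exp_le_exp.2 hpq).trans_lt hq))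
    (hu.tendsto_weightedMean_cutoff hq) fun n =>
      hu.monotoneOn_weightedMean (isRadialWeight_cutoff n) hq hpq self_mem_Iic hpq

/-- The logarithm of the square mean over balls is a convex function of the logarithm of the
radius. -/
lemma IsZeroExtension.log_ballMean_le_chord (hu : IsZeroExtension D ρ u)
    (hstar : ∀ y ∈ D, ∀ c : ℝ, 0 < c → c ≤ 1 → c • y ∈ D) {p b q : ℝ} (hpb : p < b) (hbq : b < q)
    (hq : Real.exp q < ρ) (hpos : 0 < ballMean u p) :
    (q - p) * Real.log (ballMean u b) ≤
      (q - b) * Real.log (ballMean u p) + (b - p) * Real.log (ballMean u q) := by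
  have hb : Real.exp b < ρ := (Real.exp_lt_exp.2 hbq).trans hq
  have hp : Real.exp p < ρ := (Real.exp_lt_exp.2 hpb).trans hb
  have hlim : ∀ s, p ≤ s → Real.exp s < ρ → Tendsto
      (fun n => Real.log (weightedMean (cutoff n) u s)) atTop (𝓝 (Real.log (ballMean u s))) :=
    fun s hps hs => (hu.tendsto_weightedMean_cutoff hs).log
      (hpos.trans_le (hu.ballMean_mono hps hs)).ne'
  refine le_of_tendsto_of_tendsto ((hlim b hpb.le hb).const_mul _)
    (((hlim p le_rfl hp).const_mul _).add ((hlim q (hpb.trans hbq).le hq).const_mul _)) ?_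
  filter_upwards [(hu.tendsto_weightedMean_cutoff hp).eventually_const_lt hpos] with n hn
  exact hu.log_weightedMean_le_chord (isRadialWeight_cutoff n) hstar hpb hbq hq hn

end Sharp

section Domain

variable {d : ℕ} {Ω : Set (EuclideanSpace ℝ (Fin d))} {h : EuclideanSpace ℝ (Fin d) → ℝ}

lemma sum_partialD_partialD_eq_lap {y : EuclideanSpace ℝ (Fin d)} (hh : ContDiffAt ℝ 2 h y) :
    ∑ i, partialD i (partialD i h) y = lap h y := by
  refine Finset.sum_congr rfl fun i _ => ?_
  have h1 : DifferentiableAt ℝ (fderiv ℝ h) y :=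
    (hh.fderiv_right (m := 1) (by norm_num)).differentiableAt one_ne_zero
  have h2 : partialD i h = fun z => fderiv ℝ h z (EuclideanSpace.single i 1) := rfl
  rw [iteratedFDeriv_two_apply, partialD, h2,
    fderiv_clm_apply h1 (differentiableAt_const _)]
  simp

/-- The extension of `h` by zero, recentred at `x`. -/
def recentred (Ω : Set (EuclideanSpace ℝ (Fin d))) (h : EuclideanSpace ℝ (Fin d) → ℝ)
    (x y : EuclideanSpace ℝ (Fin d)) : ℝ :=
  Ω.indicator h (x + y)

lemma isZeroExtension_recentred (hΩ : IsOpen Ω) (hcont : ContinuousOn h (closure Ω))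
    (hharm : IsHarmonicOn h Ω) {x : EuclideanSpace ℝ (Fin d)} {R : ℝ}
    (hzero : ∀ y ∈ ball x R ∩ frontier Ω, h y = 0) :
    IsZeroExtension ((fun y => x + y) ⁻¹' Ω ∩ ball 0 R) R (recentred Ω h x) := by
  have hball : ∀ y ∈ ball (0 : EuclideanSpace ℝ (Fin d)) R, x + y ∈ ball x R := fun y hy => by
    simpa using hy
  have hopen : IsOpen ((fun y => x + y) ⁻¹' Ω) := hΩ.preimage (by fun_prop)
  have heq : EqOn (recentred Ω h x) (fun y => h (x + y)) ((fun y => x + y) ⁻¹' Ω) :=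
    fun y hy => indicator_of_mem (s := Ω) hy h
  refine ⟨hopen.inter isOpen_ball, ?_, fun y hy hyD => ?_, ?_, fun y hy => ?_⟩
  · have h1 : ContinuousOn (Ω.indicator h) (ball x R) := by
      classical
      rw [← piecewise_eq_indicator]
      exact ContinuousOn.piecewise (fun y hy => hzero y hy) (hcont.mono inter_subset_right)
        continuousOn_const
    exact h1.comp (by fun_prop) hball
  · exact indicator_of_notMem (s := Ω) (fun hΩy => hyD ⟨hΩy, hy⟩) h
  · have h1 : ContDiffOn ℝ 2 (fun y => h (x + y)) ((fun y => x + y) ⁻¹' Ω) :=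
      hharm.1.comp (by fun_prop) fun _ hy => hy
    exact (h1.congr heq).mono inter_subset_left
  · have h1 : ∀ z ∈ (fun y => x + y) ⁻¹' Ω, recentred Ω h x =ᶠ[𝓝 z] fun y => h (x + y) :=
      fun z hz => heq.eventuallyEq_of_mem (hopen.mem_nhds hz)
    have h2 : ∀ i, partialD i (recentred Ω h x) =ᶠ[𝓝 y] fun z => partialD i h (x + z) := by
      intro i
      filter_upwards [hopen.mem_nhds hy.1] with z hz
      rw [partialD, (h1 z hz).fderiv_eq, fderiv_comp_add_left, partialD]
    have h3 : ∀ i, partialD i (partialD i (recentred Ω h x)) y =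
        partialD i (partialD i h) (x + y) := by
      intro i
      rw [partialD, (h2 i).fderiv_eq, fderiv_comp_add_left (f := partialD i h), partialD]
    rw [Finset.sum_congr rfl fun i _ => h3 i,
      sum_partialD_partialD_eq_lap (hharm.1.contDiffAt (hΩ.mem_nhds hy.1))]
    exact hharm.2 _ hy.1

lemma Hh_exp_eq (hΩ : IsOpen Ω) (x : EuclideanSpace ℝ (Fin d)) (s : ℝ) :
    Hh Ω h x (Real.exp s) = Real.exp (d * s) * ballMean (recentred Ω h x) s := by
  rw [ballMean, weightedMean, integral_mul_dilate_sq, ← mul_assoc, ← Real.exp_add,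
    add_neg_cancel, Real.exp_zero, one_mul, Hh,
    ← integral_indicator (isOpen_ball.inter hΩ).measurableSet,
    ← integral_add_left_eq_self _ x]
  refine integral_congr_ae (Eventually.of_forall fun z => ?_)
  have hiff : Real.exp (-(2 * s)) * ‖z‖ ^ 2 ∈ Iio (1 : ℝ) ↔ x + z ∈ ball x (Real.exp s) := by
    have h1 : Real.exp (2 * s) = Real.exp s ^ 2 := by rw [← Real.exp_nat_mul]; simp
    rw [mem_Iio, Real.exp_neg, inv_mul_lt_iff₀ (Real.exp_pos _), mul_one, h1,
      pow_lt_pow_iff_left₀ (norm_nonneg z) (Real.exp_pos s).le two_ne_zero]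
    simp
  beta_reduce
  by_cases h1 : x + z ∈ ball x (Real.exp s)
  · rw [indicator_of_mem (hiff.2 h1), recentred, one_mul]
    by_cases h2 : x + z ∈ Ω
    · rw [indicator_of_mem (mem_inter h1 h2), indicator_of_mem h2]
    · rw [indicator_of_notMem (s := ball x (Real.exp s) ∩ Ω) fun h3 => h2 h3.2,
        indicator_of_notMem h2]
      simp
  · rw [indicator_of_notMem (s := ball x (Real.exp s) ∩ Ω) fun h3 => h1 h3.1,
      indicator_of_notMem fun h3 => h1 (hiff.1 h3), zero_mul]

end Domain

/-- (Kukavica–Nyström monotonicity, Lemma 3.1.) Let `Ω ⊂ ℝ^d` be a domain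
and `B₁ = B(x₁,R₁)` a ball centered on `∂Ω` such that `∂Ω ∩ B₁` is `C³` smooth. Let `x ∈ Ω`,
`R > 0` with `Ω ∩ B(x,R)` star-shaped with respect to `x` and `B(x,R) ⊆ B₁`. If `h` is
continuous on `closure Ω`, harmonic and nonzero in `Ω`, and vanishes on `∂Ω ∩ B₁`, then for
`0 < r₁ < r₂ < r₃ < R`,
`log (H_h(x,r₂)/H_h(x,r₁)) ≤ (log(r₂/r₁)/log(r₃/r₂)) · log (H_h(x,r₃)/H_h(x,r₂))`. -/
theorem stmt_5 (m : ℕ) (Ω : Set (Euc m)) (hΩ : IsOpen Ω) (hconn : IsConnected Ω)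
    (x₁ : Euc m) (R₁ : ℝ) (hx₁ : x₁ ∈ frontier Ω) (hR₁ : 0 < R₁)
    (hC3 : ∀ y ∈ frontier Ω ∩ ball x₁ R₁, ∃ ρ : ℝ, 0 < ρ ∧ SmoothGraph 3 Ω y ρ)
    (x : Euc m) (R : ℝ) (hx : x ∈ Ω) (hR : 0 < R)
    (hstar : ∀ y ∈ Ω ∩ ball x R, segment ℝ x y ⊆ Ω ∩ ball x R)
    (hsub : ball x R ⊆ ball x₁ R₁)
    (h : Euc m → ℝ) (hcont : ContinuousOn h (closure Ω)) (hharm : IsHarmonicOn h Ω)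
    (hnz : ∃ y ∈ Ω, h y ≠ 0) (hzero : ∀ y ∈ frontier Ω ∩ ball x₁ R₁, h y = 0)
    (r₁ r₂ r₃ : ℝ) (h0 : 0 < r₁) (h12 : r₁ < r₂) (h23 : r₂ < r₃) (h3 : r₃ < R) :
    Real.log (Hh Ω h x r₂ / Hh Ω h x r₁) ≤
      (Real.log (r₂ / r₁) / Real.log (r₃ / r₂)) * Real.log (Hh Ω h x r₃ / Hh Ω h x r₂) := by
  have hu : IsZeroExtension ((fun y => x + y) ⁻¹' Ω ∩ ball 0 R) R (recentred Ω h x) :=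
    isZeroExtension_recentred hΩ hcont hharm fun y hy => hzero y ⟨hy.2, hsub hy.1⟩
  have hstar' : ∀ y ∈ (fun y => x + y) ⁻¹' Ω ∩ ball 0 R, ∀ c : ℝ, 0 < c → c ≤ 1 →
      c • y ∈ (fun y => x + y) ⁻¹' Ω ∩ ball 0 R := by
    intro y hy c hc0 hc1
    have h1 : x + c • y ∈ segment ℝ x (x + y) := by
      rw [segment_eq_image']
      exact ⟨c, ⟨hc0.le, hc1⟩, by simp⟩
    have h2 := hstar (x + y) ⟨hy.1, by simpa using hy.2⟩ h1
    exact ⟨h2.1, by simpa using h2.2⟩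
  obtain ⟨s₁, rfl⟩ : ∃ s, Real.exp s = r₁ := ⟨_, Real.exp_log h0⟩
  obtain ⟨s₂, rfl⟩ : ∃ s, Real.exp s = r₂ := ⟨_, Real.exp_log (h0.trans h12)⟩
  obtain ⟨s₃, rfl⟩ : ∃ s, Real.exp s = r₃ := ⟨_, Real.exp_log ((h0.trans h12).trans h23)⟩
  have hs12 : s₁ < s₂ := Real.exp_lt_exp.1 h12
  have hs23 : s₂ < s₃ := Real.exp_lt_exp.1 h23
  rw [← Real.exp_sub, ← Real.exp_sub, Real.log_exp, Real.log_exp]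
  have hm12 := hu.ballMean_mono hs12.le (h23.trans h3)
  have hm23 := hu.ballMean_mono hs23.le h3
  have hnn : ∀ s, 0 ≤ ballMean (recentred Ω h x) s := fun s =>
    integral_nonneg fun y => mul_nonneg (indicator_nonneg (fun _ _ => zero_le_one) _) (sq_nonneg _)
  have hlog : ∀ s, 0 < ballMean (recentred Ω h x) s → Real.log (Hh Ω h x (Real.exp s)) =
      ↑(m + 1) * s + Real.log (ballMean (recentred Ω h x) s) := fun s hs => by
    rw [Hh_exp_eq hΩ, Real.log_mul (Real.exp_pos _).ne' hs.ne', Real.log_exp]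
  have hpos : ∀ s, 0 < ballMean (recentred Ω h x) s → Hh Ω h x (Real.exp s) ≠ 0 := fun s hs => by
    rw [Hh_exp_eq hΩ]
    exact (mul_pos (Real.exp_pos _) hs).ne'
  have hzero' : ∀ s, ballMean (recentred Ω h x) s = 0 → Hh Ω h x (Real.exp s) = 0 := fun s hs => by
    rw [Hh_exp_eq hΩ, hs, mul_zero]
  rcases (hnn s₁).eq_or_lt' with hb1 | hb1
  · rw [hzero' s₁ hb1, div_zero, Real.log_zero]
    refine mul_nonneg (div_nonneg (by linarith) (by linarith)) ?_
    rcases (hnn s₂).eq_or_lt' with hb2 | hb2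
    · rw [hzero' s₂ hb2, div_zero, Real.log_zero]
    · have hb3 := hb2.trans_le hm23
      rw [Real.log_div (hpos s₃ hb3) (hpos s₂ hb2), hlog s₃ hb3, hlog s₂ hb2]
      have h1 := Real.log_le_log hb2 hm23
      have h2 : ((m + 1 : ℕ) : ℝ) * s₂ ≤ ((m + 1 : ℕ) : ℝ) * s₃ := by gcongr
      linarith
  · have hb2 := hb1.trans_le hm12
    have hb3 := hb2.trans_le hm23
    rw [Real.log_div (hpos s₃ hb3) (hpos s₂ hb2), Real.log_div (hpos s₂ hb2) (hpos s₁ hb1),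
      hlog s₃ hb3, hlog s₂ hb2, hlog s₁ hb1, div_mul_eq_mul_div, le_div_iff₀ (sub_pos.2 hs23)]
    have := hu.log_ballMean_le_chord hstar' hs12 hs23 h3 hb1
    linarith
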